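/- arXiv:1101.2932 — 3 statements merged into one kernel-verified Lean document; each statement's English description precedes it below -/
import Mathlib

section
/- Let a<b, α,β ∈ (0,1), γ ∈ [0,1], and let f,g:[a,b]→ℝ be continuously differentiable. Then ∫_a^b g(x)·(^CD^{α,β}_γ f)(x) dx = ∫_a^b f(x)·(D^{β,α}_{1−γ} g)(x) dx + [ γ f(x)·(ₓI_b^{1−α} g)(x) − (1−γ) f(x)·(ₐI_x^{1−β} g)(x) ]_{x=a}^{x=b}. -/
open MeasureTheory Set

noncomputable section

/-- Left Riemann–Liouville fractional integral of order `α` with lower limit `a`. -/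
def leftRLI (a α : ℝ) (f : ℝ → ℝ) (x : ℝ) : ℝ :=
  (1 / Real.Gamma α) * ∫ t in a..x, (x - t) ^ (α - 1) * f t

/-- Right Riemann–Liouville fractional integral of order `α` with upper limit `b`. -/
def rightRLI (b α : ℝ) (f : ℝ → ℝ) (x : ℝ) : ℝ :=
  (1 / Real.Gamma α) * ∫ t in x..b, (t - x) ^ (α - 1) * f t

/-- Left Caputo fractional derivative of order `α`. -/
def caputoL (a α : ℝ) (f : ℝ → ℝ) (x : ℝ) : ℝ :=
  (1 / Real.Gamma (1 - α)) * ∫ t in a..x, (x - t) ^ (-α) * deriv f t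

/-- Right Caputo fractional derivative of order `α`. -/
def caputoR (b α : ℝ) (f : ℝ → ℝ) (x : ℝ) : ℝ :=
  (-1 / Real.Gamma (1 - α)) * ∫ t in x..b, (t - x) ^ (-α) * deriv f t

/-- Combined Caputo fractional derivative `^C D^{α,β}_γ`. -/
def combCaputo (a b α β γ : ℝ) (f : ℝ → ℝ) (x : ℝ) : ℝ :=
  γ * caputoL a α f x + (1 - γ) * caputoR b β f x

/-- Left Riemann–Liouville fractional derivative of order `α`. -/
def leftRLD (a α : ℝ) (g : ℝ → ℝ) (x : ℝ) : ℝ :=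
  (1 / Real.Gamma (1 - α)) * deriv (fun s => ∫ t in a..s, (s - t) ^ (-α) * g t) x

/-- Right Riemann–Liouville fractional derivative of order `α`. -/
def rightRLD (b α : ℝ) (g : ℝ → ℝ) (x : ℝ) : ℝ :=
  (-1 / Real.Gamma (1 - α)) * deriv (fun s => ∫ t in s..b, (t - s) ^ (-α) * g t) x

/-- Combined Riemann–Liouville derivative `D^{β,α}_{1-γ} = (1-γ) ₐD_x^β + γ ₓD_b^α`. -/
def combRLD (a b β α γ : ℝ) (g : ℝ → ℝ) (x : ℝ) : ℝ :=
  (1 - γ) * leftRLD a β g x + γ * rightRLD b α g x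

/-- `g` is continuously differentiable on `[a,b]`. -/
def ContDiffOn1 (a b : ℝ) (g : ℝ → ℝ) : Prop :=
  (∀ x ∈ Icc a b, DifferentiableAt ℝ g x) ∧ ContinuousOn (deriv g) (Icc a b)

lemma fub_aux (a b r : ℝ) (hab : a ≤ b) (hr : -1 < r) (φ ψ : ℝ → ℝ)
    (hφ : ContinuousOn φ (Icc a b)) (hψ : ContinuousOn ψ (Icc a b)) :
    (∫ x in a..b, ψ x * ∫ t in a..x, (x - t) ^ r * φ t)
      = (∫ t in a..b, φ t * ∫ x in t..b, (x - t) ^ r * ψ x)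
    ∧ IntervalIntegrable (fun x => ψ x * ∫ t in a..x, (x - t) ^ r * φ t) volume a b
    ∧ IntervalIntegrable (fun t => φ t * ∫ x in t..b, (x - t) ^ r * ψ x) volume a b := by
  set k : ℝ → ℝ := (Icc 0 (b - a)).indicator (fun u => u ^ r) with hk
  set φ' : ℝ → ℝ := (Ioc a b).indicator φ with hφ'
  set ψ' : ℝ → ℝ := (Ioc a b).indicator ψ with hψ'
  have hkI : Integrable k := by
    rw [hk, integrable_indicator_iff measurableSet_Icc, integrableOn_Icc_iff_integrableOn_Ioc,
      ← intervalIntegrable_iff_integrableOn_Ioc_of_le (by linarith)]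
    exact intervalIntegral.intervalIntegrable_rpow' hr
  have hφI : Integrable φ' := by
    rw [hφ', integrable_indicator_iff measurableSet_Ioc]
    exact (hφ.integrableOn_Icc).mono_set Ioc_subset_Icc_self
  have hψI : Integrable ψ' := by
    rw [hψ', integrable_indicator_iff measurableSet_Ioc]
    exact (hψ.integrableOn_Icc).mono_set Ioc_subset_Icc_self
  obtain ⟨C, hC⟩ := isCompact_Icc.exists_bound_of_continuousOn hψ
  have hbd : ∀ x, ‖ψ' x‖ ≤ max C 0 := by
    intro x
    by_cases hx : x ∈ Ioc a b
    · rw [hψ', indicator_of_mem hx]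
      exact (hC x (Ioc_subset_Icc_self hx)).trans (le_max_left _ _)
    · rw [hψ', indicator_of_notMem hx]; simp
  have hconv := Integrable.convolution_integrand (ContinuousLinearMap.mul ℝ ℝ) hφI hkI
  have hG : Integrable (fun p : ℝ × ℝ => ψ' p.1 * (φ' p.2 * k (p.1 - p.2)))
      (volume.prod volume) := by
    refine Integrable.bdd_mul (c := max C 0) hconv ?_ (Filter.Eventually.of_forall fun p => hbd p.1)
    exact hψI.aestronglyMeasurable.comp_fst
  have h1 : (fun x => ∫ t, ψ' x * (φ' t * k (x - t)))
      = (Ioc a b).indicator (fun x => ψ x * ∫ t in a..x, (x - t) ^ r * φ t) := by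
    funext x
    by_cases hx : x ∈ Ioc a b
    · rw [indicator_of_mem hx, integral_const_mul, hψ', indicator_of_mem hx,
        intervalIntegral.integral_of_le hx.1.le, ← integral_indicator measurableSet_Ioc]
      congr 2
      funext t
      by_cases ht : t ∈ Ioc a x
      · rw [indicator_of_mem ht, hφ', hk, indicator_of_mem, indicator_of_mem, mul_comm]
        · constructor <;> linarith [ht.1, ht.2, hx.1, hx.2]
        · exact ⟨ht.1, ht.2.trans hx.2⟩
      · rw [indicator_of_notMem ht]
        by_cases h : t ∈ Ioc a b
        · rw [hk, indicator_of_notMem, mul_zero]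
          intro h'
          exact ht ⟨h.1, by linarith [h'.1]⟩
        · rw [hφ', indicator_of_notMem h, zero_mul]
    · rw [indicator_of_notMem hx, hψ', indicator_of_notMem hx]; simp
  have h2 : (fun t => ∫ x, ψ' x * (φ' t * k (x - t)))
      = (Ioc a b).indicator (fun t => φ t * ∫ x in t..b, (x - t) ^ r * ψ x) := by
    funext t
    by_cases ht : t ∈ Ioc a b
    · rw [indicator_of_mem ht, intervalIntegral.integral_of_le ht.2,
        ← integral_Icc_eq_integral_Ioc, ← integral_indicator measurableSet_Icc,
        ← integral_const_mul]
      congr 1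
      funext x
      rw [hφ', indicator_of_mem ht]
      by_cases hx : x ∈ Icc t b
      · rw [indicator_of_mem hx, hψ', hk, indicator_of_mem, indicator_of_mem]
        · ring
        · constructor <;> linarith [ht.1, ht.2, hx.1, hx.2]
        · exact ⟨ht.1.trans_le hx.1, hx.2⟩
      · rw [indicator_of_notMem hx]
        by_cases h : x ∈ Ioc a b
        · rw [hk, indicator_of_notMem]
          · ring
          intro h'
          exact hx ⟨by linarith [h'.1], h.2⟩
        · rw [hψ', indicator_of_notMem h]; ring
    · rw [indicator_of_notMem ht, hφ', indicator_of_notMem ht]; simp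
  refine ⟨?_, ?_, ?_⟩
  · have := integral_integral_swap (f := fun x t => ψ' x * (φ' t * k (x - t))) hG
    rw [h1, h2, integral_indicator measurableSet_Ioc, integral_indicator measurableSet_Ioc] at this
    rw [intervalIntegral.integral_of_le hab, intervalIntegral.integral_of_le hab, this]
  · have := hG.integral_prod_left
    simp only [h1] at this
    rwa [integrable_indicator_iff measurableSet_Ioc,
      ← intervalIntegrable_iff_integrableOn_Ioc_of_le hab] at this
  · have := hG.integral_prod_right
    simp only [h2] at this
    rwa [integrable_indicator_iff measurableSet_Ioc,
      ← intervalIntegrable_iff_integrableOn_Ioc_of_le hab] at this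

lemma ac_congr {f g : ℝ → ℝ} {a b : ℝ} (hf : AbsolutelyContinuousOnInterval f a b)
    (h : ∀ x ∈ uIcc a b, f x = g x) : AbsolutelyContinuousOnInterval g a b := by
  rw [absolutelyContinuousOnInterval_iff] at hf ⊢
  intro ε hε
  obtain ⟨δ, hδ, H⟩ := hf ε hε
  refine ⟨δ, hδ, fun E hE hs => ?_⟩
  refine lt_of_eq_of_lt (Finset.sum_congr rfl fun i hi => ?_) (H E hE hs)
  rw [h _ (hE.1 i hi).1, h _ (hE.1 i hi).2]

lemma cont_aux {a b : ℝ} {g : ℝ → ℝ} (hg : ContDiffOn1 a b g) : ContinuousOn g (Icc a b) :=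
  fun x hx => (hg.1 x hx).continuousAt.continuousWithinAt

lemma ac_of_C1 {a b : ℝ} (hab : a ≤ b) {f : ℝ → ℝ} (hf : ContDiffOn1 a b f) :
    AbsolutelyContinuousOnInterval f a b := by
  have hI : IntervalIntegrable (deriv f) volume a b := by
    apply ContinuousOn.intervalIntegrable; rw [uIcc_of_le hab]; exact hf.2
  have h1 := hI.absolutelyContinuousOnInterval_intervalIntegral (c := a) (by simp)
  have h2 : AbsolutelyContinuousOnInterval (fun _ : ℝ => f a) a b :=
    (LipschitzWith.const (f a)).lipschitzOnWith.absolutelyContinuousOnInterval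
  refine ac_congr (h1.add h2) fun x hx => ?_
  rw [uIcc_of_le hab] at hx
  have : ∫ t in a..x, deriv f t = f x - f a := by
    apply intervalIntegral.integral_deriv_eq_sub
    · intro t ht
      rw [uIcc_of_le hx.1] at ht
      exact hf.1 t ⟨ht.1, ht.2.trans hx.2⟩
    · apply hI.mono_set
      rw [uIcc_of_le hx.1, uIcc_of_le hab]
      exact Icc_subset_Icc_right hx.2
  simp [this]

lemma int_pow (s v r : ℝ) (hr : -1 < r) :
    ∫ t in s..v, (v - t) ^ r = (v - s) ^ (r + 1) / (r + 1) := by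
  rw [intervalIntegral.integral_comp_sub_left (fun u => u ^ r) v, integral_rpow (Or.inl hr)]
  simp [Real.zero_rpow (by linarith : r + 1 ≠ 0)]

/-- the right kernel integral is the integral of an integrable function -/
lemma rep_right (a b r : ℝ) (hab : a ≤ b) (hr : -1 < r) (g : ℝ → ℝ)
    (hg : ContDiffOn1 a b g) :
    ∃ h : ℝ → ℝ, IntervalIntegrable h volume a b ∧
      ∀ s ∈ Icc a b, ∫ t in s..b, (t - s) ^ r * g t = ∫ t in s..b, h t := by
  have hA : IntervalIntegrable (fun t => g b * (b - t) ^ r) volume a b := by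
    have := (intervalIntegral.intervalIntegrable_rpow' (a := b - a) (b := b - b) hr).comp_sub_left b
    simp only [sub_sub_cancel] at this
    exact this.const_mul _
  have hB : IntervalIntegrable (fun t => ∫ x in t..b, (x - t) ^ r * deriv g x) volume a b := by
    have := (fub_aux a b r hab hr (fun _ => 1) (deriv g) continuousOn_const hg.2).2.2
    simpa using this
  refine ⟨fun t => g b * (b - t) ^ r - ∫ x in t..b, (x - t) ^ r * deriv g x, hA.sub hB, ?_⟩
  intro s hs
  have hsub : uIcc s b ⊆ uIcc a b := by
    rw [uIcc_of_le hs.2, uIcc_of_le hab]; exact Icc_subset_Icc_left hs.1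
  rw [intervalIntegral.integral_sub (hA.mono_set hsub) (hB.mono_set hsub),
    intervalIntegral.integral_const_mul, int_pow s b r hr]
  have hF := (fub_aux s b r hs.2 hr (fun _ => 1) (deriv g) continuousOn_const
    (hg.2.mono (Icc_subset_Icc_left hs.1))).1
  simp only [mul_one, one_mul] at hF
  rw [← hF]
  simp only [int_pow s _ r hr]
  have hr1 : 0 < r + 1 := by linarith
  have hP := intervalIntegral.integral_mul_deriv_eq_deriv_mul_of_hasDerivAt
    (a := s) (b := b) (u := fun x => (x - s) ^ (r + 1) / (r + 1)) (v := g)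
    (u' := fun x => (x - s) ^ r) (v' := deriv g) ?_ ?_ ?_ ?_ ?_ ?_
  · simp only [mul_comm (deriv g _)]
    rw [hP, sub_self, Real.zero_rpow hr1.ne']
    ring
  · apply ContinuousOn.div_const
    apply ContinuousOn.rpow_const (by fun_prop)
    intro x _; right; exact hr1.le
  · rw [uIcc_of_le hs.2]
    exact (cont_aux hg).mono (Icc_subset_Icc_left hs.1)
  · intro x hx
    rw [min_eq_left hs.2] at hx
    have hx0 : x - s ≠ 0 := by linarith [hx.1]
    have := (((hasDerivAt_id x).sub_const s).rpow_const (p := r + 1) (Or.inl hx0)).div_const (r + 1)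
    refine HasDerivAt.congr_deriv (f' := 1 * (r + 1) * (x - s) ^ (r + 1 - 1) / (r + 1)) this ?_
    rw [add_sub_cancel_right]
    field_simp
  · intro x hx
    rw [min_eq_left hs.2, max_eq_right hs.2] at hx
    exact (hg.1 x ⟨hs.1.trans hx.1.le, hx.2.le⟩).hasDerivAt
  · have := (intervalIntegral.intervalIntegrable_rpow' (a := s - s) (b := b - s) hr).comp_sub_right s
    simpa using this
  · apply ContinuousOn.intervalIntegrable
    rw [uIcc_of_le hs.2]
    exact hg.2.mono (Icc_subset_Icc_left hs.1)

lemma ac_right (a b r : ℝ) (hab : a ≤ b) (hr : -1 < r) (g : ℝ → ℝ)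
    (hg : ContDiffOn1 a b g) :
    AbsolutelyContinuousOnInterval (fun s => ∫ t in s..b, (t - s) ^ r * g t) a b := by
  obtain ⟨h, hI, hh⟩ := rep_right a b r hab hr g hg
  refine ac_congr (hI.absolutelyContinuousOnInterval_intervalIntegral (c := b) (by simp)).neg ?_
  intro x hx
  rw [uIcc_of_le hab] at hx
  rw [hh x hx, intervalIntegral.integral_symm b x]
  rfl

lemma ac_left (a b r : ℝ) (hab : a ≤ b) (hr : -1 < r) (g : ℝ → ℝ)
    (hg : ContDiffOn1 a b g) :
    AbsolutelyContinuousOnInterval (fun s => ∫ t in a..s, (s - t) ^ r * g t) a b := by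
  have hg' : ContDiffOn1 (-b) (-a) (fun x => g (-x)) := by
    constructor
    · intro x hx
      have := hg.1 (-x) ⟨by linarith [hx.2], by linarith [hx.1]⟩
      exact this.comp x differentiableAt_id.neg
    · have : deriv (fun x => g (-x)) = fun x => -deriv g (-x) := by
        funext x; exact deriv_comp_neg g x
      rw [this]
      apply ContinuousOn.neg
      apply hg.2.comp continuousOn_neg
      intro x hx
      exact ⟨by linarith [hx.2], by linarith [hx.1]⟩
  obtain ⟨h, hI, hh⟩ := rep_right (-b) (-a) r (by linarith) hr _ hg'
  have hI' : IntervalIntegrable (fun x => h (-x)) volume a b := by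
    have := ((IntervalIntegrable.iff_comp_neg (by simp)).1 hI).symm
    simpa using this
  refine ac_congr (hI'.absolutelyContinuousOnInterval_intervalIntegral (c := a) (by simp)) ?_
  intro x hx
  rw [uIcc_of_le hab] at hx
  have := hh (-x) ⟨by linarith [hx.2], by linarith [hx.1]⟩
  rw [intervalIntegral.integral_comp_neg, ← this, ← intervalIntegral.integral_comp_neg]
  apply intervalIntegral.integral_congr
  intro t _
  simp only [neg_neg]
  congr 2
  ring

/-- Integration by parts for the combined Caputo derivative:
`∫_a^b g ⋅ ^CD^{α,β}_γ f = ∫_a^b f ⋅ D^{β,α}_{1-γ} g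
  + [γ f ₓI_b^{1-α} g − (1-γ) f ₐI_x^{1-β} g]_{x=a}^{x=b}`. -/
theorem combined_caputo_integration_by_parts
    (a b α β γ : ℝ) (hab : a < b) (hα : α ∈ Ioo (0:ℝ) 1) (hβ : β ∈ Ioo (0:ℝ) 1)
    (hγ : γ ∈ Icc (0:ℝ) 1) (f g : ℝ → ℝ)
    (hf : ContDiffOn1 a b f) (hg : ContDiffOn1 a b g) :
    ∫ x in a..b, g x * combCaputo a b α β γ f x
      = (∫ x in a..b, f x * combRLD a b β α γ g x)
        + ((γ * f b * rightRLI b (1 - α) g b - (1 - γ) * f b * leftRLI a (1 - β) g b)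
          - (γ * f a * rightRLI b (1 - α) g a - (1 - γ) * f a * leftRLI a (1 - β) g a)) := by

  have hα1 : -1 < -α := by linarith [hα.2]
  have hβ1 : -1 < -β := by linarith [hβ.2]
  have hu : uIcc a b = Icc a b := uIcc_of_le hab.le
  have hfa := ac_of_C1 hab.le hf
  have hR := ac_right a b (-α) hab.le hα1 g hg
  have hL := ac_left a b (-β) hab.le hβ1 g hg
  have pR := hfa.integral_mul_deriv_eq_deriv_mul hR
  have pL := hfa.integral_mul_deriv_eq_deriv_mul hL
  have iR := hR.intervalIntegrable_deriv.continuousOn_mul hfa.continuousOn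
  have iL := hL.intervalIntegrable_deriv.continuousOn_mul hfa.continuousOn
  obtain ⟨F1, I1, -⟩ := fub_aux a b (-α) hab.le hα1 (deriv f) g hf.2 (cont_aux hg)
  obtain ⟨F2, -, I2⟩ := fub_aux a b (-β) hab.le hβ1 g (deriv f) (cont_aux hg) hf.2
  have e1 : ∀ x, g x * combCaputo a b α β γ f x
      = (γ * (1 / Real.Gamma (1 - α))) * (g x * ∫ t in a..x, (x - t) ^ (-α) * deriv f t)
        + ((1 - γ) * (-1 / Real.Gamma (1 - β))) *
          (g x * ∫ t in x..b, (t - x) ^ (-β) * deriv f t) := by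
    intro x; simp only [combCaputo, caputoL, caputoR]; ring
  have e2 : ∀ x, f x * combRLD a b β α γ g x
      = ((1 - γ) * (1 / Real.Gamma (1 - β))) *
          (f x * deriv (fun s => ∫ t in a..s, (s - t) ^ (-β) * g t) x)
        + (γ * (-1 / Real.Gamma (1 - α))) *
          (f x * deriv (fun s => ∫ t in s..b, (t - s) ^ (-α) * g t) x) := by
    intro x; simp only [combRLD, leftRLD, rightRLD]; ring
  simp only [e1, e2]
  rw [intervalIntegral.integral_add (I1.const_mul _) (I2.const_mul _),
    intervalIntegral.integral_add (iL.const_mul _) (iR.const_mul _)]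
  simp only [intervalIntegral.integral_const_mul]
  rw [pL, pR, F1, ← F2]
  have ea : 1 - α - 1 = -α := by ring
  have eb : 1 - β - 1 = -β := by ring
  simp only [rightRLI, leftRLI, ea, eb]
  ring

end
end

section
/- Let a<b, α,β ∈ (0,1), γ ∈ [0,1], N ∈ ℕ, L ∈ C¹([a,b]×ℝ^{3N};ℝ), and y,h ∈ D. Assume that for each i = 2,…,N+1 the function x ↦ ∂_{N+i}L[y](x) is continuously differentiable on [a,b] and the function x ↦ ∂_{2N+i}L[y](x) admits continuous Riemann–Liouville derivatives ₐD_x^β and ₓD_b^α on [a,b]. Then the first variation δJ(y;h) := (d/dε) J(y+εh)|_{ε=0} of J(y) = ∫_a^b L[y](x) dx exists and equals ∫_a^b Σ_{i=2}^{N+1} [ ∂_iL[y](x) − (d/dx)∂_{N+i}L[y](x) + (D^{β,α}_{1−γ} ∂_{2N+i}L[y])(x) ] h_{i−1}(x) dx + [ Σ_{i=2}^{N+1} h_{i−1}(x)·∂_{N+i}L[y](x) ]_{x=a}^{x=b} + γ [ Σ_{i=2}^{N+1} h_{i−1}(x)·(ₓI_b^{1−α} ∂_{2N+i}L[y])(x)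 ]_{x=a}^{x=b} − (1−γ) [ Σ_{i=2}^{N+1} h_{i−1}(x)·(ₐI_x^{1−β} ∂_{2N+i}L[y])(x) ]_{x=a}^{x=b}. -/
open MeasureTheory Set

noncomputable section

/-- Componentwise combined Caputo derivative of a vector-valued function. -/
def combCaputoVec (a b α β γ : ℝ) {N : ℕ} (y : ℝ → Fin N → ℝ) (x : ℝ) : Fin N → ℝ :=
  fun i => combCaputo a b α β γ (fun t => y t i) x

/-- The class `D`: `y'` and `^C D^{α,β}_γ y` exist and are continuous on `[a,b]`. -/
def MemD (a b α β γ : ℝ) {N : ℕ} (y : ℝ → Fin N → ℝ) : Prop :=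
  (∀ x ∈ Icc a b, DifferentiableAt ℝ y x) ∧
  ContinuousOn (deriv y) (Icc a b) ∧
  ContinuousOn (combCaputoVec a b α β γ y) (Icc a b)

/-- The norm `‖·‖_{1,∞}` on `D`. -/
def norm1inf (a b α β γ : ℝ) {N : ℕ} (y : ℝ → Fin N → ℝ) : ℝ :=
  sSup ((fun x => ‖y x‖) '' Icc a b) + sSup ((fun x => ‖deriv y x‖) '' Icc a b) +
    sSup ((fun x => ‖combCaputoVec a b α β γ y x‖) '' Icc a b)

/-- Partial derivative of `L` with respect to the `i`-th component of its second
(vector) argument, i.e. `∂_{i+2} L` in the paper's numbering (`i : Fin N` ↦ `i+2`). -/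
def pY {N : ℕ} (L : ℝ → (Fin N → ℝ) → (Fin N → ℝ) → (Fin N → ℝ) → ℝ)
    (x : ℝ) (u v w : Fin N → ℝ) (i : Fin N) : ℝ :=
  deriv (fun s => L x (Function.update u i s) v w) (u i)

/-- Partial derivative w.r.t. the `i`-th component of the third argument (`∂_{N+i+2} L`). -/
def pV {N : ℕ} (L : ℝ → (Fin N → ℝ) → (Fin N → ℝ) → (Fin N → ℝ) → ℝ)
    (x : ℝ) (u v w : Fin N → ℝ) (i : Fin N) : ℝ :=
  deriv (fun s => L x u (Function.update v i s) w) (v i)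

/-- Partial derivative w.r.t. the `i`-th component of the fourth argument (`∂_{2N+i+2} L`). -/
def pW {N : ℕ} (L : ℝ → (Fin N → ℝ) → (Fin N → ℝ) → (Fin N → ℝ) → ℝ)
    (x : ℝ) (u v w : Fin N → ℝ) (i : Fin N) : ℝ :=
  deriv (fun s => L x u v (Function.update w i s)) (w i)

/-- `L[y](x) = L(x, y(x), y'(x), ^C D^{α,β}_γ y(x))`. -/
def lagAlong (a b α β γ : ℝ) {N : ℕ} (L : ℝ → (Fin N → ℝ) → (Fin N → ℝ) → (Fin N → ℝ) → ℝ)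
    (y : ℝ → Fin N → ℝ) (x : ℝ) : ℝ :=
  L x (y x) (deriv y x) (combCaputoVec a b α β γ y x)

def pYAlong (a b α β γ : ℝ) {N : ℕ} (L : ℝ → (Fin N → ℝ) → (Fin N → ℝ) → (Fin N → ℝ) → ℝ)
    (y : ℝ → Fin N → ℝ) (i : Fin N) (x : ℝ) : ℝ :=
  pY L x (y x) (deriv y x) (combCaputoVec a b α β γ y x) i

def pVAlong (a b α β γ : ℝ) {N : ℕ} (L : ℝ → (Fin N → ℝ) → (Fin N → ℝ) → (Fin N → ℝ) → ℝ)
    (y : ℝ → Fin N → ℝ) (i : Fin N) (x : ℝ) : ℝ :=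
  pV L x (y x) (deriv y x) (combCaputoVec a b α β γ y x) i

def pWAlong (a b α β γ : ℝ) {N : ℕ} (L : ℝ → (Fin N → ℝ) → (Fin N → ℝ) → (Fin N → ℝ) → ℝ)
    (y : ℝ → Fin N → ℝ) (i : Fin N) (x : ℝ) : ℝ :=
  pW L x (y x) (deriv y x) (combCaputoVec a b α β γ y x) i

/-- `g` admits a continuous left Riemann–Liouville derivative `ₐD_x^β` on `[a,b]`. -/
def HasContLeftRLD (a b β : ℝ) (g : ℝ → ℝ) : Prop :=
  (∀ x ∈ Icc a b, DifferentiableAt ℝ (fun s => ∫ t in a..s, (s - t) ^ (-β) * g t) x) ∧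
  ContinuousOn (leftRLD a β g) (Icc a b)

/-- `g` admits a continuous right Riemann–Liouville derivative `ₓD_b^α` on `[a,b]`. -/
def HasContRightRLD (a b α : ℝ) (g : ℝ → ℝ) : Prop :=
  (∀ x ∈ Icc a b, DifferentiableAt ℝ (fun s => ∫ t in s..b, (t - s) ^ (-α) * g t) x) ∧
  ContinuousOn (rightRLD b α g) (Icc a b)

/-- The functional `J(y) = ∫_a^b L[y](x) dx`. -/
def Jfun (a b α β γ : ℝ) {N : ℕ} (L : ℝ → (Fin N → ℝ) → (Fin N → ℝ) → (Fin N → ℝ) → ℝ)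
    (y : ℝ → Fin N → ℝ) : ℝ :=
  ∫ x in a..b, lagAlong a b α β γ L y x


theorem aux_ibp (a b : ℝ) (hab : a < b) (f G : ℝ → ℝ)
    (hf : ∀ x ∈ Icc a b, DifferentiableAt ℝ f x) (hf' : ContinuousOn (deriv f) (Icc a b))
    (hG : ∀ x ∈ Icc a b, DifferentiableAt ℝ G x) (hG' : ContinuousOn (deriv G) (Icc a b)) :
    (∫ x in a..b, deriv f x * G x) = f b * G b - f a * G a - ∫ x in a..b, f x * deriv G x := by
  rw [← uIcc_of_le hab.le] at hf hf' hG hG'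
  have := intervalIntegral.integral_mul_deriv_eq_deriv_mul
    (fun x hx => (hf x hx).hasDerivAt) (fun x hx => (hG x hx).hasDerivAt)
    hf'.intervalIntegrable hG'.intervalIntegrable
  linarith

theorem aux_fub (a b α : ℝ) (hα : α ∈ Ioo (0:ℝ) 1) (f g : ℝ → ℝ)
    (hf : ContinuousOn f (Icc a b)) (hg : ContinuousOn g (Icc a b)) (hab : a < b) :
    IntervalIntegrable (fun x => f x * ∫ t in a..x, (x - t) ^ (-α) * g t) volume a b ∧
    IntervalIntegrable (fun t => g t * ∫ x in t..b, (x - t) ^ (-α) * f x) volume a b ∧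
    (∫ x in a..b, f x * ∫ t in a..x, (x - t) ^ (-α) * g t) =
      ∫ t in a..b, g t * ∫ x in t..b, (x - t) ^ (-α) * f x := by
  obtain ⟨hα0, hα1⟩ := hα
  have hk : Integrable (indicator (Ioc 0 (b - a)) (fun u : ℝ => u ^ (-α))) volume := by
    rw [integrable_indicator_iff measurableSet_Ioc,
      ← intervalIntegrable_iff_integrableOn_Ioc_of_le (by linarith)]
    exact intervalIntegral.intervalIntegrable_rpow' (by linarith)
  have hgi : Integrable (indicator (Ioc a b) g) volume := by
    rw [integrable_indicator_iff measurableSet_Ioc]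
    exact (hg.integrableOn_Icc).mono_set Ioc_subset_Icc_self
  have hfi : Integrable (indicator (Ioc a b) f) volume := by
    rw [integrable_indicator_iff measurableSet_Ioc]
    exact (hf.integrableOn_Icc).mono_set Ioc_subset_Icc_self
  have h1 := Integrable.convolution_integrand (μ := volume) (ν := volume)
    (ContinuousLinearMap.mul ℝ ℝ) hgi hk
  obtain ⟨C, hC⟩ := isCompact_Icc.exists_bound_of_continuousOn hf
  have hCb : ∀ x, ‖indicator (Ioc a b) f x‖ ≤ |C| := by
    intro x
    by_cases hx : x ∈ Ioc a b
    · rw [indicator_of_mem hx]; exact (hC x (Ioc_subset_Icc_self hx)).trans (le_abs_self C)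
    · rw [indicator_of_notMem hx]; simp
  have h2 := h1.bdd_mul (c := |C|) (f := fun p : ℝ × ℝ => indicator (Ioc a b) f p.1)
    (hfi.aestronglyMeasurable.comp_fst) (Filter.Eventually.of_forall fun p => hCb p.1)
  simp only [ContinuousLinearMap.mul_apply'] at h2
  have e1 : (fun x => ∫ t, indicator (Ioc a b) f x * (indicator (Ioc a b) g t *
      indicator (Ioc 0 (b - a)) (fun u : ℝ => u ^ (-α)) (x - t))) =
      indicator (Ioc a b) (fun x => f x * ∫ t in a..x, (x - t) ^ (-α) * g t) := by
    funext x
    by_cases hx : x ∈ Ioc a b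
    · rw [indicator_of_mem hx, indicator_of_mem hx, intervalIntegral.integral_of_le hx.1.le,
        integral_const_mul, ← integral_indicator measurableSet_Ioc]
      congr 2
      funext t
      simp only [indicator_apply, mem_Ioc]
      obtain ⟨hx1, hx2⟩ := hx
      by_cases ht : a < t ∧ t ≤ x
      · rw [if_pos ht, if_pos ⟨ht.1, ht.2.trans hx2⟩]
        rcases ht.2.eq_or_lt with h | h
        · subst h
          simp [Real.zero_rpow (show -α ≠ 0 by linarith)]
        · rw [if_pos ⟨by linarith, by linarith [ht.1]⟩, mul_comm]
      · rw [if_neg ht]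
        by_cases h3 : a < t ∧ t ≤ b
        · rw [if_pos h3, if_neg, mul_zero]
          rintro ⟨h4, h5⟩
          exact ht ⟨h3.1, by linarith⟩
        · rw [if_neg h3, zero_mul]
    · rw [indicator_of_notMem hx, indicator_of_notMem hx]; simp
  have e2 : (fun t => ∫ x, indicator (Ioc a b) f x * (indicator (Ioc a b) g t *
      indicator (Ioc 0 (b - a)) (fun u : ℝ => u ^ (-α)) (x - t))) =
      indicator (Ioc a b) (fun t => g t * ∫ x in t..b, (x - t) ^ (-α) * f x) := by
    funext t
    by_cases ht : t ∈ Ioc a b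
    · rw [indicator_of_mem ht, indicator_of_mem ht, intervalIntegral.integral_of_le ht.2,
        ← integral_const_mul, ← integral_indicator measurableSet_Ioc]
      congr 1
      funext x
      simp only [indicator_apply, mem_Ioc]
      obtain ⟨ht1, ht2⟩ := ht
      by_cases hx : t < x ∧ x ≤ b
      · rw [if_pos hx, if_pos ⟨ht1.trans hx.1, hx.2⟩,
          if_pos ⟨by linarith [hx.1], by linarith [hx.2]⟩]
        ring
      · rw [if_neg hx]
        by_cases h3 : a < x ∧ x ≤ b
        · rw [if_pos h3, if_neg, mul_zero, mul_zero]
          rintro ⟨h4, h5⟩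
          exact hx ⟨by linarith, h3.2⟩
        · rw [if_neg h3, zero_mul]
    · rw [indicator_of_notMem ht, indicator_of_notMem ht]; simp
  have i1 := h2.integral_prod_left
  have i2 := h2.integral_prod_right
  simp only at i1 i2
  have sw := integral_integral_swap (f := fun x t => indicator (Ioc a b) f x *
    (indicator (Ioc a b) g t * indicator (Ioc 0 (b - a)) (fun u : ℝ => u ^ (-α)) (x - t))) h2
  rw [e1] at i1
  rw [e2] at i2
  have sw' : (∫ x, indicator (Ioc a b) (fun x => f x * ∫ t in a..x, (x - t) ^ (-α) * g t) x) =
      ∫ x, indicator (Ioc a b) (fun t => g t * ∫ x in t..b, (x - t) ^ (-α) * f x) x := by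
    rw [← e1, ← e2]; exact sw
  refine ⟨?_, ?_, ?_⟩
  · rw [intervalIntegrable_iff_integrableOn_Ioc_of_le hab.le]
    exact (integrable_indicator_iff measurableSet_Ioc).1 i1
  · rw [intervalIntegrable_iff_integrableOn_Ioc_of_le hab.le]
    exact (integrable_indicator_iff measurableSet_Ioc).1 i2
  · rw [intervalIntegral.integral_of_le hab.le, intervalIntegral.integral_of_le hab.le,
      ← integral_indicator measurableSet_Ioc, ← integral_indicator measurableSet_Ioc]
    exact sw'

theorem aux_kerL (a b α : ℝ) (hα : α ∈ Ioo (0:ℝ) 1) (g : ℝ → ℝ)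
    (hg : ContinuousOn g (Icc a b)) (x : ℝ) (hx : x ∈ Icc a b) :
    IntervalIntegrable (fun t => (x - t) ^ (-α) * g t) volume a x := by
  have h0 : IntervalIntegrable (fun u : ℝ => u ^ (-α)) volume (x - a) (x - x) :=
    intervalIntegral.intervalIntegrable_rpow' (by linarith [hα.2])
  have h1 := h0.comp_sub_left x
  simp only [sub_sub_cancel] at h1
  apply h1.mul_continuousOn
  rw [uIcc_of_le hx.1]
  exact hg.mono (Icc_subset_Icc_right hx.2)

theorem aux_kerR (a b α : ℝ) (hα : α ∈ Ioo (0:ℝ) 1) (g : ℝ → ℝ)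
    (hg : ContinuousOn g (Icc a b)) (x : ℝ) (hx : x ∈ Icc a b) :
    IntervalIntegrable (fun t => (t - x) ^ (-α) * g t) volume x b := by
  have h0 : IntervalIntegrable (fun u : ℝ => u ^ (-α)) volume (x - x) (b - x) :=
    intervalIntegral.intervalIntegrable_rpow' (by linarith [hα.2])
  have h1 := h0.comp_sub_right x
  simp only [sub_add_cancel] at h1
  apply h1.mul_continuousOn
  rw [uIcc_of_le hx.2]
  exact hg.mono (Icc_subset_Icc_left hx.1)

/-- fractional integration by parts for one component -/
theorem aux_parts (a b α β γ : ℝ) (hab : a < b)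
    (hα : α ∈ Ioo (0:ℝ) 1) (hβ : β ∈ Ioo (0:ℝ) 1) (f w : ℝ → ℝ)
    (hf : ∀ x ∈ Icc a b, DifferentiableAt ℝ f x) (hf' : ContinuousOn (deriv f) (Icc a b))
    (hw : ContinuousOn w (Icc a b)) (hl : HasContLeftRLD a b β w)
    (hr : HasContRightRLD a b α w) :
    (∫ x in a..b, w x * combCaputo a b α β γ f x) =
      (∫ x in a..b, combRLD a b β α γ w x * f x)
      + γ * (f b * rightRLI b (1 - α) w b - f a * rightRLI b (1 - α) w a)
      - (1 - γ) * (f b * leftRLI a (1 - β) w b - f a * leftRLI a (1 - β) w a) := by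
  have hfc : ContinuousOn f (Icc a b) := fun x hx => (hf x hx).continuousAt.continuousWithinAt
  obtain ⟨A1, -, A3⟩ := aux_fub a b α hα w (deriv f) hw hf' hab
  obtain ⟨-, B2, B3⟩ := aux_fub a b β hβ (deriv f) w hf' hw hab
  have gα : Real.Gamma (1 - α) ≠ 0 := (Real.Gamma_pos_of_pos (by linarith [hα.2])).ne'
  have gβ : Real.Gamma (1 - β) ≠ 0 := (Real.Gamma_pos_of_pos (by linarith [hβ.2])).ne'
  have e : ∀ x, w x * combCaputo a b α β γ f x =
      (γ * (1 / Real.Gamma (1 - α))) * (w x * ∫ t in a..x, (x - t) ^ (-α) * deriv f t) +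
      ((1 - γ) * (-1 / Real.Gamma (1 - β))) * (w x * ∫ t in x..b, (t - x) ^ (-β) * deriv f t) := by
    intro x; simp only [combCaputo, caputoL, caputoR]; ring
  simp only [e]
  rw [intervalIntegral.integral_add (A1.const_mul _) (B2.const_mul _),
    intervalIntegral.integral_const_mul, intervalIntegral.integral_const_mul, A3, ← B3]
  have hfi : IntervalIntegrable (deriv f) volume a b :=
    ContinuousOn.intervalIntegrable (by rwa [uIcc_of_le hab.le])
  have dl : ContinuousOn (deriv (fun s => ∫ t in a..s, (s - t) ^ (-β) * w t)) (Icc a b) := by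
    have : deriv (fun s => ∫ t in a..s, (s - t) ^ (-β) * w t) =
        fun x => Real.Gamma (1 - β) * leftRLD a β w x := by
      funext x; simp only [leftRLD]; field_simp
    rw [this]; exact continuousOn_const.mul hl.2
  have dr : ContinuousOn (deriv (fun s => ∫ t in s..b, (t - s) ^ (-α) * w t)) (Icc a b) := by
    have : deriv (fun s => ∫ t in s..b, (t - s) ^ (-α) * w t) =
        fun x => -Real.Gamma (1 - α) * rightRLD b α w x := by
      funext x; simp only [rightRLD]; field_simp
    rw [this]; exact continuousOn_const.mul hr.2
  have pl := aux_ibp a b hab f _ hf hf' hl.1 dl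
  have pr := aux_ibp a b hab f _ hf hf' hr.1 dr
  rw [pl, pr]
  have e2 : ∀ x, combRLD a b β α γ w x * f x =
      ((1 - γ) * (1 / Real.Gamma (1 - β))) *
        (f x * deriv (fun s => ∫ t in a..s, (s - t) ^ (-β) * w t) x) +
      (γ * (-1 / Real.Gamma (1 - α))) *
        (f x * deriv (fun s => ∫ t in s..b, (t - s) ^ (-α) * w t) x) := by
    intro x; simp only [combRLD, leftRLD, rightRLD]; ring
  simp only [e2]
  rw [intervalIntegral.integral_add, intervalIntegral.integral_const_mul,
    intervalIntegral.integral_const_mul]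
  · simp only [rightRLI, leftRLI, show ∀ x : ℝ, 1 - x - 1 = -x by intro x; ring]
    ring
  · refine (ContinuousOn.intervalIntegrable ?_).const_mul _
    rw [uIcc_of_le hab.le]; exact hfc.mul dl
  · refine (ContinuousOn.intervalIntegrable ?_).const_mul _
    rw [uIcc_of_le hab.le]; exact hfc.mul dr

theorem aux_var {E : Type*} [NormedAddCommGroup E] [NormedSpace ℝ E] (a b : ℝ) (hab : a < b)
    (F : E → ℝ) (hF : ContDiff ℝ 1 F) (P Q : ℝ → E)
    (hP : ContinuousOn P (Icc a b)) (hQ : ContinuousOn Q (Icc a b)) :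
    HasDerivAt (fun ε : ℝ => ∫ x in a..b, F (P x + ε • Q x))
      (∫ x in a..b, fderiv ℝ F (P x) (Q x)) 0 := by
  have hc : ContinuousOn (fun p : ℝ × ℝ => fderiv ℝ F (P p.2 + p.1 • Q p.2) (Q p.2))
      (Icc (-1) 1 ×ˢ Icc a b) := by
    have hP2 : ContinuousOn (fun p : ℝ × ℝ => P p.2) (Icc (-1) 1 ×ˢ Icc a b) :=
      hP.comp continuousOn_snd fun p hp => hp.2
    have hQ2 : ContinuousOn (fun p : ℝ × ℝ => Q p.2) (Icc (-1) 1 ×ˢ Icc a b) :=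
      hQ.comp continuousOn_snd fun p hp => hp.2
    exact ((hF.continuous_fderiv one_ne_zero).comp_continuousOn
      (hP2.add (continuousOn_fst.smul hQ2))).clm_apply hQ2
  obtain ⟨C, hC⟩ := (isCompact_Icc.prod isCompact_Icc).exists_bound_of_continuousOn hc
  have hcF : ∀ ε : ℝ, ContinuousOn (fun x => F (P x + ε • Q x)) (Icc a b) := fun ε =>
    hF.continuous.comp_continuousOn (hP.add (continuousOn_const.smul hQ))
  have hc0 : ContinuousOn (fun x => fderiv ℝ F (P x + (0:ℝ) • Q x) (Q x)) (Icc a b) :=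
    ((hF.continuous_fderiv one_ne_zero).comp_continuousOn
      (hP.add (continuousOn_const.smul hQ))).clm_apply hQ
  have hsub : uIoc a b ⊆ Icc a b := by rw [uIoc_of_le hab.le]; exact Ioc_subset_Icc_self
  have main := intervalIntegral.hasDerivAt_integral_of_dominated_loc_of_deriv_le
    (μ := volume) (a := a) (b := b) (bound := fun _ => C) (x₀ := (0:ℝ)) (s := Icc (-1) 1)
    (F := fun ε x => F (P x + ε • Q x))
    (F' := fun ε x => fderiv ℝ F (P x + ε • Q x) (Q x))
    (Icc_mem_nhds (by norm_num) (by norm_num))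
    (Filter.Eventually.of_forall fun ε =>
      ((hcF ε).mono hsub).aestronglyMeasurable measurableSet_uIoc)
    (ContinuousOn.intervalIntegrable (by rw [uIcc_of_le hab.le]; exact hcF 0))
    ((hc0.mono hsub).aestronglyMeasurable measurableSet_uIoc)
    (Filter.Eventually.of_forall fun t ht ε hε => hC (ε, t) ⟨hε, hsub ht⟩)
    intervalIntegrable_const
    (Filter.Eventually.of_forall fun t ht ε hε => by
      have h1 : HasDerivAt (fun ε : ℝ => P t + ε • Q t) (Q t) ε := by
        simpa using ((hasDerivAt_id ε).smul_const (Q t)).const_add (P t)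
      exact ((hF.differentiable one_ne_zero) _).hasFDerivAt.comp_hasDerivAt ε h1)
  simpa using main.2

theorem aux_caputo (a b α β γ : ℝ) (hα : α ∈ Ioo (0:ℝ) 1) (hβ : β ∈ Ioo (0:ℝ) 1)
    (f g : ℝ → ℝ)
    (hf : ∀ x ∈ Icc a b, DifferentiableAt ℝ f x) (hf' : ContinuousOn (deriv f) (Icc a b))
    (hg : ∀ x ∈ Icc a b, DifferentiableAt ℝ g x) (hg' : ContinuousOn (deriv g) (Icc a b))
    (ε x : ℝ) (hx : x ∈ Icc a b) :
    combCaputo a b α β γ (fun t => f t + ε * g t) x =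
      combCaputo a b α β γ f x + ε * combCaputo a b α β γ g x := by
  have hd : ∀ t ∈ Icc a b, deriv (fun t => f t + ε * g t) t = deriv f t + ε * deriv g t :=
    fun t ht => ((hf t ht).hasDerivAt.add ((hg t ht).hasDerivAt.const_mul ε)).deriv
  have e1 : (∫ t in a..x, (x - t) ^ (-α) * deriv (fun t => f t + ε * g t) t) =
      (∫ t in a..x, (x - t) ^ (-α) * deriv f t) +
        ε * ∫ t in a..x, (x - t) ^ (-α) * deriv g t := by
    rw [← intervalIntegral.integral_const_mul, ← intervalIntegral.integral_add
      (aux_kerL a b α hα _ hf' x hx) ((aux_kerL a b α hα _ hg' x hx).const_mul ε)]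
    apply intervalIntegral.integral_congr
    intro t ht
    rw [uIcc_of_le hx.1] at ht
    simp only
    rw [hd t ⟨ht.1, ht.2.trans hx.2⟩]; ring
  have e2 : (∫ t in x..b, (t - x) ^ (-β) * deriv (fun t => f t + ε * g t) t) =
      (∫ t in x..b, (t - x) ^ (-β) * deriv f t) +
        ε * ∫ t in x..b, (t - x) ^ (-β) * deriv g t := by
    rw [← intervalIntegral.integral_const_mul, ← intervalIntegral.integral_add
      (aux_kerR a b β hβ _ hf' x hx) ((aux_kerR a b β hβ _ hg' x hx).const_mul ε)]
    apply intervalIntegral.integral_congr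
    intro t ht
    rw [uIcc_of_le hx.2] at ht
    simp only
    rw [hd t ⟨hx.1.trans ht.1, ht.2⟩]; ring
  simp only [combCaputo, caputoL, caputoR, e1, e2]
  ring

theorem aux_comb (a b α β γ : ℝ) {N : ℕ} (hα : α ∈ Ioo (0:ℝ) 1) (hβ : β ∈ Ioo (0:ℝ) 1)
    (y h : ℝ → Fin N → ℝ)
    (hy : ∀ x ∈ Icc a b, DifferentiableAt ℝ y x) (hy' : ContinuousOn (deriv y) (Icc a b))
    (hh : ∀ x ∈ Icc a b, DifferentiableAt ℝ h x) (hh' : ContinuousOn (deriv h) (Icc a b))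
    (ε x : ℝ) (hx : x ∈ Icc a b) :
    combCaputoVec a b α β γ (y + ε • h) x =
      combCaputoVec a b α β γ y x + ε • combCaputoVec a b α β γ h x := by
  have d : ∀ z : ℝ → Fin N → ℝ, (∀ x ∈ Icc a b, DifferentiableAt ℝ z x) → ∀ i, ∀ x ∈ Icc a b,
      HasDerivAt (fun t => z t i) (deriv z x i) x := fun z hz i x hx =>
    hasDerivAt_pi.1 (hz x hx).hasDerivAt i
  have c : ∀ z : ℝ → Fin N → ℝ, (∀ x ∈ Icc a b, DifferentiableAt ℝ z x) →
      ContinuousOn (deriv z) (Icc a b) → ∀ i, ContinuousOn (deriv fun t => z t i) (Icc a b) :=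
    fun z hz hz' i => (continuousOn_pi.1 hz' i).congr fun x hx => (d z hz i x hx).deriv
  funext i
  exact aux_caputo a b α β γ hα hβ (fun t => y t i) (fun t => h t i)
    (fun x hx => (d y hy i x hx).differentiableAt) (c y hy hy' i)
    (fun x hx => (d h hh i x hx).differentiableAt) (c h hh hh' i) ε x hx

theorem aux_pY {N : ℕ} (L : ℝ → (Fin N → ℝ) → (Fin N → ℝ) → (Fin N → ℝ) → ℝ)
    (hL : ContDiff ℝ 1 fun p : ℝ × (Fin N → ℝ) × (Fin N → ℝ) × (Fin N → ℝ) =>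
      L p.1 p.2.1 p.2.2.1 p.2.2.2) (x : ℝ) (u v w : Fin N → ℝ) (i : Fin N) :
    pY L x u v w i = fderiv ℝ (fun p : ℝ × (Fin N → ℝ) × (Fin N → ℝ) × (Fin N → ℝ) =>
      L p.1 p.2.1 p.2.2.1 p.2.2.2) (x, u, v, w) (0, Pi.single i 1, 0, 0) := by
  have h1 : HasDerivAt (fun s : ℝ => (x, Function.update u i s, v, w))
      ((0:ℝ), Pi.single i 1, (0 : Fin N → ℝ), (0 : Fin N → ℝ)) (u i) :=
    (hasDerivAt_const _ _).prodMk ((hasDerivAt_update u i _).prodMk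
      ((hasDerivAt_const _ _).prodMk (hasDerivAt_const _ _)))
  have h2 := ((hL.differentiable one_ne_zero)
    (x, Function.update u i (u i), v, w)).hasFDerivAt.comp_hasDerivAt (u i) h1
  rw [Function.update_eq_self] at h2
  exact h2.deriv

theorem aux_pV {N : ℕ} (L : ℝ → (Fin N → ℝ) → (Fin N → ℝ) → (Fin N → ℝ) → ℝ)
    (hL : ContDiff ℝ 1 fun p : ℝ × (Fin N → ℝ) × (Fin N → ℝ) × (Fin N → ℝ) =>
      L p.1 p.2.1 p.2.2.1 p.2.2.2) (x : ℝ) (u v w : Fin N → ℝ) (i : Fin N) :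
    pV L x u v w i = fderiv ℝ (fun p : ℝ × (Fin N → ℝ) × (Fin N → ℝ) × (Fin N → ℝ) =>
      L p.1 p.2.1 p.2.2.1 p.2.2.2) (x, u, v, w) (0, 0, Pi.single i 1, 0) := by
  have h1 : HasDerivAt (fun s : ℝ => (x, u, Function.update v i s, w))
      ((0:ℝ), (0 : Fin N → ℝ), Pi.single i 1, (0 : Fin N → ℝ)) (v i) :=
    (hasDerivAt_const _ _).prodMk ((hasDerivAt_const _ _).prodMk
      ((hasDerivAt_update v i _).prodMk (hasDerivAt_const _ _)))
  have h2 := ((hL.differentiable one_ne_zero)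
    (x, u, Function.update v i (v i), w)).hasFDerivAt.comp_hasDerivAt (v i) h1
  rw [Function.update_eq_self] at h2
  exact h2.deriv

theorem aux_pW {N : ℕ} (L : ℝ → (Fin N → ℝ) → (Fin N → ℝ) → (Fin N → ℝ) → ℝ)
    (hL : ContDiff ℝ 1 fun p : ℝ × (Fin N → ℝ) × (Fin N → ℝ) × (Fin N → ℝ) =>
      L p.1 p.2.1 p.2.2.1 p.2.2.2) (x : ℝ) (u v w : Fin N → ℝ) (i : Fin N) :
    pW L x u v w i = fderiv ℝ (fun p : ℝ × (Fin N → ℝ) × (Fin N → ℝ) × (Fin N → ℝ) =>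
      L p.1 p.2.1 p.2.2.1 p.2.2.2) (x, u, v, w) (0, 0, 0, Pi.single i 1) := by
  have h1 : HasDerivAt (fun s : ℝ => (x, u, v, Function.update w i s))
      ((0:ℝ), (0 : Fin N → ℝ), (0 : Fin N → ℝ), Pi.single i 1) (w i) :=
    (hasDerivAt_const _ _).prodMk ((hasDerivAt_const _ _).prodMk
      ((hasDerivAt_const _ _).prodMk (hasDerivAt_update w i _)))
  have h2 := ((hL.differentiable one_ne_zero)
    (x, u, v, Function.update w i (w i))).hasFDerivAt.comp_hasDerivAt (w i) h1
  rw [Function.update_eq_self] at h2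
  exact h2.deriv

theorem aux_expand {N : ℕ} (T : ℝ × (Fin N → ℝ) × (Fin N → ℝ) × (Fin N → ℝ) →L[ℝ] ℝ)
    (u v w : Fin N → ℝ) :
    T (0, u, v, w) = ∑ i, (u i * T (0, Pi.single i 1, 0, 0) + v i * T (0, 0, Pi.single i 1, 0) +
      w i * T (0, 0, 0, Pi.single i 1)) := by
  have h : ((0:ℝ), u, v, w) = ∑ i, (u i • ((0:ℝ), Pi.single i (1:ℝ), (0 : Fin N → ℝ), (0 : Fin N → ℝ))
      + v i • ((0:ℝ), (0 : Fin N → ℝ), Pi.single i (1:ℝ), (0 : Fin N → ℝ)) +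
      w i • ((0:ℝ), (0 : Fin N → ℝ), (0 : Fin N → ℝ), Pi.single i (1:ℝ))) := by
    simp only [Prod.smul_mk, Prod.mk_add_mk, smul_zero, add_zero, zero_add]
    refine Prod.ext ?_ (Prod.ext ?_ (Prod.ext ?_ ?_))
    · simp [Prod.fst_sum]
    · simpa [Prod.fst_sum, Prod.snd_sum] using pi_eq_sum_univ' u
    · simpa [Prod.fst_sum, Prod.snd_sum] using pi_eq_sum_univ' v
    · simpa [Prod.fst_sum, Prod.snd_sum] using pi_eq_sum_univ' w
  rw [h, map_sum]
  simp only [map_add, map_smul, smul_eq_mul]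

/-- The first variation of `J(y) = ∫_a^b L[y](x) dx` at `y ∈ D` in the direction `h ∈ D`
exists and is given by the fractional integration-by-parts formula. -/
theorem first_variation_formula
    (a b α β γ : ℝ) (N : ℕ) (hab : a < b)
    (hα : α ∈ Ioo (0:ℝ) 1) (hβ : β ∈ Ioo (0:ℝ) 1) (hγ : γ ∈ Icc (0:ℝ) 1)
    (L : ℝ → (Fin N → ℝ) → (Fin N → ℝ) → (Fin N → ℝ) → ℝ)
    (hL : ContDiff ℝ 1 fun p : ℝ × (Fin N → ℝ) × (Fin N → ℝ) × (Fin N → ℝ) =>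
      L p.1 p.2.1 p.2.2.1 p.2.2.2)
    (y h : ℝ → Fin N → ℝ) (hy : MemD a b α β γ y) (hh : MemD a b α β γ h)
    (hC1 : ∀ i : Fin N, ContDiffOn1 a b (pVAlong a b α β γ L y i))
    (hRL : ∀ i : Fin N, HasContLeftRLD a b β (pWAlong a b α β γ L y i) ∧
      HasContRightRLD a b α (pWAlong a b α β γ L y i)) :
    HasDerivAt (fun ε : ℝ => Jfun a b α β γ L (y + ε • h))
      ((∫ x in a..b, ∑ i : Fin N,
          (pYAlong a b α β γ L y i x - deriv (pVAlong a b α β γ L y i) x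
            + combRLD a b β α γ (pWAlong a b α β γ L y i) x) * h x i)
        + ((∑ i : Fin N, h b i * pVAlong a b α β γ L y i b)
            - ∑ i : Fin N, h a i * pVAlong a b α β γ L y i a)
        + γ * ((∑ i : Fin N, h b i * rightRLI b (1 - α) (pWAlong a b α β γ L y i) b)
            - ∑ i : Fin N, h a i * rightRLI b (1 - α) (pWAlong a b α β γ L y i) a)
        - (1 - γ) * ((∑ i : Fin N, h b i * leftRLI a (1 - β) (pWAlong a b α β γ L y i) b)
            - ∑ i : Fin N, h a i * leftRLI a (1 - β) (pWAlong a b α β γ L y i) a))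
      0 := by
  obtain ⟨hy1, hy2, hy3⟩ := hy
  obtain ⟨hh1, hh2, hh3⟩ := hh
  have hyc : ContinuousOn y (Icc a b) := fun x hx => (hy1 x hx).continuousAt.continuousWithinAt
  have hhc : ContinuousOn h (Icc a b) := fun x hx => (hh1 x hx).continuousAt.continuousWithinAt
  have hPc : ContinuousOn (fun x => (x, y x, deriv y x, combCaputoVec a b α β γ y x)) (Icc a b) :=
    continuousOn_id.prodMk (hyc.prodMk (hy2.prodMk hy3))
  have hQc : ContinuousOn (fun x => ((0:ℝ), h x, deriv h x, combCaputoVec a b α β γ h x))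
      (Icc a b) := continuousOn_const.prodMk (hhc.prodMk (hh2.prodMk hh3))
  have key := aux_var a b hab _ hL _ _ hPc hQc
  have hJ : (fun ε : ℝ => Jfun a b α β γ L (y + ε • h)) = fun ε : ℝ => ∫ x in a..b,
      (fun p : ℝ × (Fin N → ℝ) × (Fin N → ℝ) × (Fin N → ℝ) =>
      L p.1 p.2.1 p.2.2.1 p.2.2.2) ((x, y x, deriv y x, combCaputoVec a b α β γ y x) +
        ε • ((0:ℝ), h x, deriv h x, combCaputoVec a b α β γ h x)) := by
    funext ε
    apply intervalIntegral.integral_congr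
    intro x hx
    rw [uIcc_of_le hab.le] at hx
    have e1 : deriv (y + ε • h) x = deriv y x + ε • deriv h x :=
      ((hy1 x hx).hasDerivAt.add ((hh1 x hx).hasDerivAt.const_smul ε)).deriv
    simp only [lagAlong, e1, aux_comb a b α β γ hα hβ y h hy1 hy2 hh1 hh2 ε x hx]
    simp
  rw [hJ]
  convert key using 1
  -- continuity of the partial derivatives
  have hD : ContinuousOn (fun x => fderiv ℝ (fun p : ℝ × (Fin N → ℝ) × (Fin N → ℝ) × (Fin N → ℝ) =>
      L p.1 p.2.1 p.2.2.1 p.2.2.2) (x, y x, deriv y x, combCaputoVec a b α β γ y x)) (Icc a b) :=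
    (hL.continuous_fderiv one_ne_zero).comp_continuousOn hPc
  have cY : ∀ i, ContinuousOn (pYAlong a b α β γ L y i) (Icc a b) := by
    intro i
    have : pYAlong a b α β γ L y i = _ := funext fun x => aux_pY L hL x _ _ _ i
    rw [this]; exact hD.clm_apply continuousOn_const
  have cV : ∀ i, ContinuousOn (pVAlong a b α β γ L y i) (Icc a b) := by
    intro i
    have : pVAlong a b α β γ L y i = _ := funext fun x => aux_pV L hL x _ _ _ i
    rw [this]; exact hD.clm_apply continuousOn_const
  have cW : ∀ i, ContinuousOn (pWAlong a b α β γ L y i) (Icc a b) := by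
    intro i
    have : pWAlong a b α β γ L y i = _ := funext fun x => aux_pW L hL x _ _ _ i
    rw [this]; exact hD.clm_apply continuousOn_const
  have chi : ∀ i, ContinuousOn (fun x => h x i) (Icc a b) := continuousOn_pi.1 hhc
  have ch'i : ∀ i, ContinuousOn (fun x => deriv h x i) (Icc a b) := continuousOn_pi.1 hh2
  have cCi : ∀ i, ContinuousOn (fun x => combCaputoVec a b α β γ h x i) (Icc a b) :=
    continuousOn_pi.1 hh3
  have dhi : ∀ i, ∀ x ∈ Icc a b, HasDerivAt (fun t => h t i) (deriv h x i) x := fun i x hx =>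
    hasDerivAt_pi.1 (hh1 x hx).hasDerivAt i
  have cdh : ∀ i, ContinuousOn (deriv (fun t => h t i)) (Icc a b) := fun i =>
    (ch'i i).congr fun x hx => (dhi i x hx).deriv
  have cR : ∀ i, ContinuousOn (combRLD a b β α γ (pWAlong a b α β γ L y i)) (Icc a b) := fun i =>
    (continuousOn_const.mul (hRL i).1.2).add (continuousOn_const.mul (hRL i).2.2)
  have ii : ∀ {f : ℝ → ℝ}, ContinuousOn f (Icc a b) → IntervalIntegrable f volume a b := by
    intro f hf
    exact ContinuousOn.intervalIntegrable (by rwa [uIcc_of_le hab.le])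
  have hexp : (∫ x in a..b, (fderiv ℝ (fun p : ℝ × (Fin N → ℝ) × (Fin N → ℝ) × (Fin N → ℝ) =>
      L p.1 p.2.1 p.2.2.1 p.2.2.2) (x, y x, deriv y x, combCaputoVec a b α β γ y x))
      ((0:ℝ), h x, deriv h x, combCaputoVec a b α β γ h x)) =
      ∑ i, ((∫ x in a..b, pYAlong a b α β γ L y i x * h x i) +
        (∫ x in a..b, deriv (fun t => h t i) x * pVAlong a b α β γ L y i x) +
        ∫ x in a..b, pWAlong a b α β γ L y i x * combCaputo a b α β γ (fun t => h t i) x) := by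
    have : ∀ i, ((∫ x in a..b, pYAlong a b α β γ L y i x * h x i) +
        (∫ x in a..b, deriv (fun t => h t i) x * pVAlong a b α β γ L y i x) +
        ∫ x in a..b, pWAlong a b α β γ L y i x * combCaputo a b α β γ (fun t => h t i) x) =
        ∫ x in a..b, (pYAlong a b α β γ L y i x * h x i +
          deriv (fun t => h t i) x * pVAlong a b α β γ L y i x +
          pWAlong a b α β γ L y i x * combCaputo a b α β γ (fun t => h t i) x) := by
      intro i
      rw [intervalIntegral.integral_add, intervalIntegral.integral_add]
      · exact ii ((cY i).mul (chi i))
      · exact ii ((cdh i).mul (cV i))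
      · exact ii (((cY i).mul (chi i)).add ((cdh i).mul (cV i)))
      · exact ii ((cW i).mul (cCi i))
    simp only [this]
    rw [← intervalIntegral.integral_finsetSum]
    · apply intervalIntegral.integral_congr
      intro x hx
      rw [uIcc_of_le hab.le] at hx
      simp only
      rw [aux_expand]
      refine Finset.sum_congr rfl fun i _ => ?_
      rw [(dhi i x hx).deriv]
      simp only [pYAlong, pVAlong, pWAlong, aux_pY L hL, aux_pV L hL, aux_pW L hL, combCaputoVec]
      ring
    · intro i _
      exact ii ((((cY i).mul (chi i)).add ((cdh i).mul (cV i))).add ((cW i).mul (cCi i)))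
  rw [hexp, intervalIntegral.integral_finsetSum]
  · simp only [← Finset.sum_sub_distrib, Finset.mul_sum, ← Finset.sum_add_distrib]
    refine Finset.sum_congr rfl fun i _ => ?_
    rw [aux_parts a b α β γ hab hα hβ (fun t => h t i) _
      (fun x hx => (dhi i x hx).differentiableAt) (cdh i) (cW i) (hRL i).1 (hRL i).2,
      aux_ibp a b hab (fun t => h t i) _ (fun x hx => (dhi i x hx).differentiableAt) (cdh i)
      (hC1 i).1 (hC1 i).2]
    have : ∀ x, (pYAlong a b α β γ L y i x - deriv (pVAlong a b α β γ L y i) x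
            + combRLD a b β α γ (pWAlong a b α β γ L y i) x) * h x i =
        pYAlong a b α β γ L y i x * h x i - h x i * deriv (pVAlong a b α β γ L y i) x
            + combRLD a b β α γ (pWAlong a b α β γ L y i) x * h x i := fun x => by ring
    simp only [this]
    rw [intervalIntegral.integral_add, intervalIntegral.integral_sub]
    · ring
    · exact ii ((cY i).mul (chi i))
    · exact ii ((chi i).mul (hC1 i).2)
    · exact ii (((cY i).mul (chi i)).sub ((chi i).mul (hC1 i).2))
    · exact ii ((cR i).mul (chi i))
  · intro i _
    exact ii ((((cY i).sub (hC1 i).2).add (cR i)).mul (chi i))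

end
end

section
/- Let a<b, α,β ∈ (0,1), γ ∈ [0,1], N ∈ ℕ, L ∈ C¹([a,b]×ℝ^{3N};ℝ), and y^a, y^b ∈ ℝ^N. Suppose y = (y_1,…,y_N) ∈ D with y(a)=y^a and y(b)=y^b is a local minimizer of J(y) = ∫_a^b L[y](x) dx among all functions in D satisfying the same boundary conditions, and assume that for each i = 2,…,N+1 the function x ↦ ∂_{N+i}L[y](x) is continuously differentiable on [a,b] and the function x ↦ ∂_{2N+i}L[y](x) admits continuous Riemann–Liouville derivatives ₐD_x^β and ₓD_b^α on [a,b]. Then y satisfies the system of N Euler–Lagrange equations ∂_iL[y](x) − (d/dx)∂_{N+i}L[y](x) + (D^{β,α}_{1−γ} ∂_{2N+i}L[y])(x) = 0, for i = 2,…,N+1 and all x ∈ [a,b]. -/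
open MeasureTheory Set

noncomputable section

open Filter Topology

/-- Truncated power kernel. -/
def hK (c r : ℝ) (s : ℝ) : ℝ := (Ioc 0 c).indicator (fun s => s ^ (-r)) s

lemma hK_int {c r : ℝ} (hr : r < 1) (hc : 0 ≤ c) : Integrable (hK c r) := by
  have h := intervalIntegral.intervalIntegrable_rpow' (a := 0) (b := c) (r := -r) (by linarith)
  rw [intervalIntegrable_iff_integrableOn_Ioc_of_le hc] at h
  exact (integrable_indicator_iff measurableSet_Ioc).2 h

lemma left_eq {a b r x : ℝ} (hr : 0 < r) (hx : x ∈ Icc a b) (h : ℝ → ℝ) :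
    ∫ t in a..x, (x - t) ^ (-r) * h t = ∫ t, (Ioc a b).indicator h t * hK (b - a) r (x - t) := by
  rw [intervalIntegral.integral_of_le hx.1, ← integral_indicator measurableSet_Ioc]
  congr 1; ext t
  simp only [hK, indicator, mem_Ioc]
  obtain ⟨h1, h2⟩ := hx
  rcases lt_trichotomy t x with h3 | h3 | h3
  · by_cases h4 : a < t
    · rw [if_pos ⟨h4, h3.le⟩, if_pos ⟨h4, by linarith⟩, if_pos ⟨by linarith, by linarith⟩, mul_comm]
    · rw [if_neg (by tauto), if_neg (by tauto), zero_mul]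
  · subst h3
    simp [Real.zero_rpow (neg_ne_zero.2 hr.ne')]
  · rw [if_neg (by rintro ⟨_, _⟩; linarith), if_neg (c := 0 < x - t ∧ _) (by rintro ⟨_, _⟩; linarith),
      mul_zero]

lemma right_eq {a b r x : ℝ} (hx : x ∈ Icc a b) (h : ℝ → ℝ) :
    ∫ t in x..b, (t - x) ^ (-r) * h t = ∫ t, (Ioc a b).indicator h t * hK (b - a) r (t - x) := by
  rw [intervalIntegral.integral_of_le hx.2, ← integral_indicator measurableSet_Ioc]
  congr 1; ext t
  simp only [hK, indicator, mem_Ioc]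
  obtain ⟨h1, h2⟩ := hx
  by_cases h3 : x < t
  · by_cases h4 : t ≤ b
    · rw [if_pos ⟨h3, h4⟩, if_pos ⟨by linarith, by linarith⟩, if_pos ⟨by linarith, by linarith⟩,
        mul_comm]
    · rw [if_neg (by tauto), if_neg (by tauto), zero_mul]
  · rw [if_neg (by tauto), if_neg (c := 0 < t - x ∧ _) (by rintro ⟨_, _⟩; linarith), mul_zero]

lemma ind_int {a b : ℝ} {h : ℝ → ℝ} (hh : ContinuousOn h (Icc a b)) :
    Integrable ((Ioc a b).indicator h) :=
  (integrable_indicator_iff measurableSet_Ioc).2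
    (hh.integrableOn_Icc.mono_set Ioc_subset_Icc_self)

lemma frac_fubini {a b r : ℝ} (hab : a < b) (hr0 : 0 < r) (hr : r < 1) {g h : ℝ → ℝ}
    (hg : ContinuousOn g (Icc a b)) (hh : ContinuousOn h (Icc a b)) :
    ∫ x in a..b, g x * (∫ t in a..x, (x - t) ^ (-r) * h t) =
      ∫ t in a..b, h t * (∫ x in t..b, (x - t) ^ (-r) * g x) := by
  have key : Integrable (fun p : ℝ × ℝ => (Ioc a b).indicator g p.1 *
      ((Ioc a b).indicator h p.2 * hK (b - a) r (p.1 - p.2))) (volume.prod volume) := by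
    have h1 := (ind_int hh).convolution_integrand (ContinuousLinearMap.mul ℝ ℝ)
      (hK_int hr (sub_nonneg.2 hab.le))
    simp only [ContinuousLinearMap.mul_apply'] at h1
    obtain ⟨C, hC⟩ := isCompact_Icc.exists_bound_of_continuousOn hg
    refine h1.bdd_mul (c := |C|) ?_ ?_
    · exact (ind_int hg).aestronglyMeasurable.comp_fst
    · refine Eventually.of_forall fun p => ?_
      by_cases hp : p.1 ∈ Ioc a b
      · rw [indicator_of_mem hp]
        exact (hC _ (Ioc_subset_Icc_self hp)).trans (le_abs_self _)
      · rw [indicator_of_notMem hp]; simp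
  have sw := integral_integral_swap (f := fun x t => (Ioc a b).indicator g x *
      ((Ioc a b).indicator h t * hK (b - a) r (x - t))) key
  have e1 : ∫ x in a..b, g x * (∫ t in a..x, (x - t) ^ (-r) * h t) =
      ∫ x, ∫ t, (Ioc a b).indicator g x *
      ((Ioc a b).indicator h t * hK (b - a) r (x - t)) := by
    rw [intervalIntegral.integral_of_le hab.le, ← integral_indicator measurableSet_Ioc]
    congr 1; ext x
    rw [integral_const_mul]
    by_cases hx : x ∈ Ioc a b
    · rw [indicator_of_mem hx, indicator_of_mem hx, left_eq hr0 (Ioc_subset_Icc_self hx)]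
    · rw [indicator_of_notMem hx, indicator_of_notMem hx, zero_mul]
  have e2 : ∫ t in a..b, h t * (∫ x in t..b, (x - t) ^ (-r) * g x) =
      ∫ t, ∫ x, (Ioc a b).indicator g x *
      ((Ioc a b).indicator h t * hK (b - a) r (x - t)) := by
    rw [intervalIntegral.integral_of_le hab.le, ← integral_indicator measurableSet_Ioc]
    congr 1; ext x
    have : ∀ t, (Ioc a b).indicator g t *
      ((Ioc a b).indicator h x * hK (b - a) r (t - x)) = (Ioc a b).indicator h x * (
       (Ioc a b).indicator g t * hK (b - a) r (t - x)) := fun t => by ring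
    simp_rw [this]
    rw [integral_const_mul]
    by_cases hx : x ∈ Ioc a b
    · rw [indicator_of_mem hx, indicator_of_mem hx, right_eq (Ioc_subset_Icc_self hx)]
    · rw [indicator_of_notMem hx, indicator_of_notMem hx, zero_mul]
  rw [e1, e2, sw]

lemma left_cont {a b r : ℝ} (hab : a < b) (hr0 : 0 < r) (hr : r < 1) {h : ℝ → ℝ}
    (hh : Continuous h) (hs : ∀ x, x ∉ Ioo a b → h x = 0) (hc : HasCompactSupport h) :
    ContinuousOn (fun x => ∫ t in a..x, (x - t) ^ (-r) * h t) (Icc a b) := by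
  have h1 := hc.continuous_convolution_left (ContinuousLinearMap.mul ℝ ℝ) hh
    (hK_int hr (sub_nonneg.2 hab.le)).locallyIntegrable (μ := volume)
  refine h1.continuousOn.congr fun x hx => ?_
  simp only [left_eq hr0 hx, convolution_def, ContinuousLinearMap.mul_apply']
  congr 1; ext t
  congr 1
  by_cases ht : t ∈ Ioc a b
  · rw [indicator_of_mem ht]
  · rw [indicator_of_notMem ht, hs t (fun h => ht (Ioo_subset_Ioc_self h))]

lemma right_cont {a b r : ℝ} (hab : a < b) (hr : r < 1) {h : ℝ → ℝ}
    (hh : Continuous h) (hs : ∀ x, x ∉ Ioo a b → h x = 0) (hc : HasCompactSupport h) :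
    ContinuousOn (fun x => ∫ t in x..b, (t - x) ^ (-r) * h t) (Icc a b) := by
  have h1 := hc.continuous_convolution_left (ContinuousLinearMap.mul ℝ ℝ) hh
    (hK_int hr (sub_nonneg.2 hab.le)).comp_neg.locallyIntegrable (μ := volume)
  refine h1.continuousOn.congr fun x hx => ?_
  simp only [right_eq hx, convolution_def, ContinuousLinearMap.mul_apply', neg_sub]
  congr 1; ext t
  congr 1
  by_cases ht : t ∈ Ioc a b
  · rw [indicator_of_mem ht]
  · rw [indicator_of_notMem ht, hs t (fun h => ht (Ioo_subset_Ioc_self h))]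

lemma left_ii {a b r x : ℝ} (hr : r < 1) (hx : x ∈ Icc a b) {h : ℝ → ℝ}
    (hh : ContinuousOn h (Icc a b)) :
    IntervalIntegrable (fun t => (x - t) ^ (-r) * h t) volume a x := by
  have h1 := (intervalIntegral.intervalIntegrable_rpow' (a := x - a) (b := x - x) (r := -r)
    (by linarith)).comp_sub_left x
  simp only [sub_sub_cancel] at h1
  refine h1.mul_continuousOn (hh.mono ?_)
  rw [uIcc_of_le hx.1]; exact Icc_subset_Icc_right hx.2

lemma right_ii {a b r x : ℝ} (hr : r < 1) (hx : x ∈ Icc a b) {h : ℝ → ℝ}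
    (hh : ContinuousOn h (Icc a b)) :
    IntervalIntegrable (fun t => (t - x) ^ (-r) * h t) volume x b := by
  have h1 := (intervalIntegral.intervalIntegrable_rpow' (a := x - x) (b := b - x) (r := -r)
    (by linarith)).comp_sub_right x
  simp only [sub_add_cancel] at h1
  refine h1.mul_continuousOn (hh.mono ?_)
  rw [uIcc_of_le hx.2]; exact Icc_subset_Icc_left hx.1

lemma combCaputo_const_mul (a b α β γ c : ℝ) (f : ℝ → ℝ) (x : ℝ) :
    combCaputo a b α β γ (fun t => c * f t) x = c * combCaputo a b α β γ f x := by
  simp only [combCaputo, caputoL, caputoR, deriv_const_mul_field]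
  have e1 : ∀ t, (x - t) ^ (-α) * (c * deriv f t) = c * ((x - t) ^ (-α) * deriv f t) :=
    fun t => by ring
  have e2 : ∀ t, (t - x) ^ (-β) * (c * deriv f t) = c * ((t - x) ^ (-β) * deriv f t) :=
    fun t => by ring
  simp only [e1, e2, intervalIntegral.integral_const_mul]
  ring

lemma combCaputo_add {a b α β γ x : ℝ} (hα : α < 1) (hβ : β < 1) (hx : x ∈ Icc a b)
    {f g : ℝ → ℝ} (hf : ∀ x ∈ Icc a b, DifferentiableAt ℝ f x)
    (hg : ∀ x ∈ Icc a b, DifferentiableAt ℝ g x)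
    (hf' : ContinuousOn (deriv f) (Icc a b)) (hg' : ContinuousOn (deriv g) (Icc a b)) :
    combCaputo a b α β γ (fun t => f t + g t) x =
      combCaputo a b α β γ f x + combCaputo a b α β γ g x := by
  have hd : ∀ t ∈ Icc a b, deriv (fun t => f t + g t) t = deriv f t + deriv g t :=
    fun t ht => deriv_fun_add (hf t ht) (hg t ht)
  simp only [combCaputo, caputoL, caputoR]
  have e1 : ∫ t in a..x, (x - t) ^ (-α) * deriv (fun t => f t + g t) t =
      (∫ t in a..x, (x - t) ^ (-α) * deriv f t) + ∫ t in a..x, (x - t) ^ (-α) * deriv g t := by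
    rw [← intervalIntegral.integral_add (left_ii hα hx hf') (left_ii hα hx hg')]
    refine intervalIntegral.integral_congr fun t ht => ?_
    rw [uIcc_of_le hx.1] at ht
    simp only [hd t ⟨ht.1, ht.2.trans hx.2⟩, mul_add]
  have e2 : ∫ t in x..b, (t - x) ^ (-β) * deriv (fun t => f t + g t) t =
      (∫ t in x..b, (t - x) ^ (-β) * deriv f t) + ∫ t in x..b, (t - x) ^ (-β) * deriv g t := by
    rw [← intervalIntegral.integral_add (right_ii hβ hx hf') (right_ii hβ hx hg')]
    refine intervalIntegral.integral_congr fun t ht => ?_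
    rw [uIcc_of_le hx.2] at ht
    simp only [hd t ⟨hx.1.trans ht.1, ht.2⟩, mul_add]
  rw [e1, e2]; ring

lemma frac_ibp {a b α β γ : ℝ} (hab : a < b) (hα : α ∈ Ioo (0:ℝ) 1) (hβ : β ∈ Ioo (0:ℝ) 1)
    {g η : ℝ → ℝ} (hg : ContinuousOn g (Icc a b)) (hη : ContDiff ℝ 1 η)
    (h0a : η a = 0) (h0b : η b = 0) (hcont : HasCompactSupport η) (hs : ∀ x, x ∉ Ioo a b → deriv η x = 0)
    (hl : HasContLeftRLD a b β g) (hr : HasContRightRLD a b α g) :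
    ∫ x in a..b, combCaputo a b α β γ η x * g x = ∫ x in a..b, η x * combRLD a b β α γ g x := by
  have hη' : Continuous (deriv η) := hη.continuous_deriv (by norm_num)
  have hηd : ∀ x, HasDerivAt η (deriv η x) x := fun x =>
    ((hη.differentiable (by norm_num)) x).hasDerivAt
  have hΓα : Real.Gamma (1 - α) ≠ 0 := (Real.Gamma_pos_of_pos (by linarith [hα.2])).ne'
  have hΓβ : Real.Gamma (1 - β) ≠ 0 := (Real.Gamma_pos_of_pos (by linarith [hβ.2])).ne'
  -- the two Riemann--Liouville integrals
  set PL : ℝ → ℝ := fun s => ∫ t in a..s, (s - t) ^ (-β) * g t with hGL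
  set PR : ℝ → ℝ := fun s => ∫ t in s..b, (t - s) ^ (-α) * g t with hGR
  have hGL' : ContinuousOn (deriv PL) (Icc a b) := by
    refine (hl.2.const_smul (Real.Gamma (1 - β))).congr fun x _ => ?_
    simp only [Pi.smul_apply, leftRLD, smul_eq_mul, hGL]; field_simp
  have hGR' : ContinuousOn (deriv PR) (Icc a b) := by
    refine (hr.2.const_smul (-Real.Gamma (1 - α))).congr fun x _ => ?_
    simp only [Pi.smul_apply, rightRLD, smul_eq_mul, hGR]; field_simp
  have ibp : ∀ G : ℝ → ℝ, (∀ x ∈ Icc a b, DifferentiableAt ℝ G x) →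
      ContinuousOn (deriv G) (Icc a b) →
      ∫ x in a..b, deriv η x * G x = - ∫ x in a..b, η x * deriv G x := by
    intro G hG hG'
    have := intervalIntegral.integral_mul_deriv_eq_deriv_mul (a := a) (b := b) (u := η)
      (u' := deriv η) (v := G) (v' := deriv G) (fun x _ => hηd x)
      (fun x hx => (hG x (by rwa [uIcc_of_le hab.le] at hx)).hasDerivAt)
      (hη'.intervalIntegrable _ _) (hG'.intervalIntegrable_of_Icc hab.le)
    rw [this, h0a, h0b]; ring
  have f1 : ∫ x in a..b, g x * (∫ t in a..x, (x - t) ^ (-α) * deriv η t) =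
      - ∫ x in a..b, η x * deriv PR x := by
    rw [frac_fubini hab hα.1 hα.2 hg hη'.continuousOn, ← ibp PR hr.1 hGR']
  have f2 : ∫ x in a..b, g x * (∫ t in x..b, (t - x) ^ (-β) * deriv η t) =
      - ∫ x in a..b, η x * deriv PL x := by
    rw [← frac_fubini hab hβ.1 hβ.2 hη'.continuousOn hg, ← ibp PL hl.1 hGL']
  have cL := left_cont hab hα.1 hα.2 hη' hs hcont.deriv
  have cR := right_cont hab hβ.2 hη' hs hcont.deriv
  have l1 : ∫ x in a..b, combCaputo a b α β γ η x * g x =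
      ∫ x in a..b, ((γ / Real.Gamma (1 - α)) * (g x * (∫ t in a..x, (x - t) ^ (-α) * deriv η t)) +
        (-(1 - γ) / Real.Gamma (1 - β)) * (g x * (∫ t in x..b, (t - x) ^ (-β) * deriv η t))) := by
    congr 1; ext x; simp only [combCaputo, caputoL, caputoR]; ring
  have l2 : ∫ x in a..b, η x * combRLD a b β α γ g x =
      ∫ x in a..b, ((-γ / Real.Gamma (1 - α)) * (η x * deriv PR x) +
        ((1 - γ) / Real.Gamma (1 - β)) * (η x * deriv PL x)) := by
    congr 1; ext x; simp only [combRLD, leftRLD, rightRLD, hGL, hGR]; ring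
  rw [l1, l2, intervalIntegral.integral_add, intervalIntegral.integral_add]
  · simp only [intervalIntegral.integral_const_mul]
    rw [f1, f2]; ring
  · exact (((hη.continuous.continuousOn).mul hGR').const_smul
      (-γ / Real.Gamma (1 - α))).intervalIntegrable_of_Icc hab.le
  · exact (((hη.continuous.continuousOn).mul hGL').const_smul
      ((1 - γ) / Real.Gamma (1 - β))).intervalIntegrable_of_Icc hab.le
  · exact ((hg.mul cL).const_smul (γ / Real.Gamma (1 - α))).intervalIntegrable_of_Icc hab.le
  · exact ((hg.mul cR).const_smul (-(1 - γ) / Real.Gamma (1 - β))).intervalIntegrable_of_Icc hab.le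

lemma first_variation {E : Type*} [NormedAddCommGroup E] [NormedSpace ℝ E] {a b : ℝ} (hab : a < b)
    {F : E → ℝ} (hF : ContDiff ℝ 1 F) {p q : ℝ → E} (hp : ContinuousOn p (Icc a b))
    (hq : ContinuousOn q (Icc a b)) :
    HasDerivAt (fun ε : ℝ => ∫ x in a..b, F (p x + ε • q x))
      (∫ x in a..b, fderiv ℝ F (p x) (q x)) 0 := by
  have hF' : Continuous (fderiv ℝ F) := hF.continuous_fderiv (by norm_num)
  have hc2 : ContinuousOn (fun z : ℝ × ℝ => fderiv ℝ F (p z.2 + z.1 • q z.2) (q z.2))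
      (Icc (-1) 1 ×ˢ Icc a b) := by
    have hp2 : ContinuousOn (fun z : ℝ × ℝ => p z.2) (Icc (-1) 1 ×ˢ Icc a b) :=
      hp.comp continuousOn_snd fun z hz => hz.2
    have hq2 : ContinuousOn (fun z : ℝ × ℝ => q z.2) (Icc (-1) 1 ×ˢ Icc a b) :=
      hq.comp continuousOn_snd fun z hz => hz.2
    exact (hF'.comp_continuousOn (hp2.add (continuousOn_fst.smul hq2))).clm_apply hq2
  obtain ⟨C, hC⟩ := (isCompact_Icc.prod isCompact_Icc).exists_bound_of_continuousOn hc2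
  have hcF : ∀ ε : ℝ, ContinuousOn (fun x => F (p x + ε • q x)) (Icc a b) := fun ε =>
    hF.continuous.comp_continuousOn (hp.add (hq.const_smul ε))
  have hsub : uIoc a b ⊆ Icc a b := by rw [uIoc_of_le hab.le]; exact Ioc_subset_Icc_self
  have := intervalIntegral.hasDerivAt_integral_of_dominated_loc_of_deriv_le (μ := volume)
    (a := a) (b := b) (F := fun (ε : ℝ) x => F (p x + ε • q x))
    (F' := fun (ε : ℝ) x => fderiv ℝ F (p x + ε • q x) (q x)) (x₀ := (0:ℝ)) (s := Icc (-1) 1)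
    (bound := fun _ => C) (Icc_mem_nhds (by norm_num) (by norm_num))
    (Eventually.of_forall fun ε => ((hcF ε).mono hsub).aestronglyMeasurable measurableSet_uIoc)
    ((hcF 0).intervalIntegrable_of_Icc hab.le)
    (by
      refine ContinuousOn.aestronglyMeasurable ?_ measurableSet_uIoc
      exact ((hF'.comp_continuousOn (hp.add (hq.const_smul 0))).clm_apply hq).mono hsub)
    (Eventually.of_forall fun x hx ε hε => hC (ε, x) ⟨hε, hsub hx⟩)
    (by simp)
    (Eventually.of_forall fun x hx ε hε => by
      have h1 : HasFDerivAt F (fderiv ℝ F (p x + ε • q x)) (p x + ε • q x) :=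
        (hF.differentiable (by norm_num) _).hasFDerivAt
      have h2 : HasDerivAt (fun ε : ℝ => p x + ε • q x) (q x) ε := by
        simpa using ((hasDerivAt_id ε).smul_const (q x)).const_add (p x)
      exact h1.comp_hasDerivAt ε h2)
  simpa using this.2

lemma norm1inf_scale (a b α β γ ε : ℝ) {N : ℕ} (Y : ℝ → Fin N → ℝ) :
    norm1inf a b α β γ (fun t => ε • Y t) = |ε| * norm1inf a b α β γ Y := by
  have key : ∀ f g : ℝ → Fin N → ℝ, (∀ x, g x = ε • f x) →
      sSup ((fun x => ‖g x‖) '' Icc a b) = |ε| * sSup ((fun x => ‖f x‖) '' Icc a b) := by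
    intro f g hfg
    rw [← smul_eq_mul, ← Real.sSup_smul_of_nonneg (abs_nonneg ε), ← image_smul, image_image]
    simp only [hfg, norm_smul, Real.norm_eq_abs, smul_eq_mul]
  simp only [norm1inf]
  rw [key Y (fun t => ε • Y t) (fun _ => rfl), key (deriv Y) (deriv (fun t => ε • Y t)),
    key (combCaputoVec a b α β γ Y) (combCaputoVec a b α β γ (fun t => ε • Y t))]
  · ring
  · intro x; ext j
    simp only [combCaputoVec, Pi.smul_apply, smul_eq_mul]
    exact combCaputo_const_mul a b α β γ ε (fun t => Y t j) x
  · intro x; exact deriv_fun_const_smul_field ε Y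

lemma hasDerivAt_comp_pi {N : ℕ} {y : ℝ → Fin N → ℝ} {x : ℝ} (h : DifferentiableAt ℝ y x)
    (j : Fin N) : HasDerivAt (fun t => y t j) (deriv y x j) x :=
  hasDerivAt_pi.1 h.hasDerivAt j

lemma update_path {N : ℕ} (u : Fin N → ℝ) (i : Fin N) (s : ℝ) :
    HasDerivAt (fun s => Function.update u i s) (Pi.single i (1:ℝ)) s := by
  exact hasDerivAt_update u i s

section pd
variable {N : ℕ} {L : ℝ → (Fin N → ℝ) → (Fin N → ℝ) → (Fin N → ℝ) → ℝ}

/-- The uncurried Lagrangian. -/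
def uncL (L : ℝ → (Fin N → ℝ) → (Fin N → ℝ) → (Fin N → ℝ) → ℝ) :
    ℝ × (Fin N → ℝ) × (Fin N → ℝ) × (Fin N → ℝ) → ℝ :=
  fun p => L p.1 p.2.1 p.2.2.1 p.2.2.2

lemma pY_eq (hL : ContDiff ℝ 1 (uncL L)) (x : ℝ) (u v w : Fin N → ℝ) (i : Fin N) :
    pY L x u v w i = fderiv ℝ (uncL L) (x, u, v, w) (0, Pi.single i 1, 0, 0) := by
  have h1 : HasFDerivAt (uncL L) (fderiv ℝ (uncL L) (x, u, v, w))
      (x, Function.update u i (u i), v, w) := by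
    rw [Function.update_eq_self]; exact (hL.differentiable (by norm_num) _).hasFDerivAt
  have h2 := (hasDerivAt_const (u i) x).prodMk ((update_path u i (u i)).prodMk
    ((hasDerivAt_const (u i) v).prodMk (hasDerivAt_const (u i) w)))
  exact (h1.comp_hasDerivAt (u i) h2).deriv

lemma pV_eq (hL : ContDiff ℝ 1 (uncL L)) (x : ℝ) (u v w : Fin N → ℝ) (i : Fin N) :
    pV L x u v w i = fderiv ℝ (uncL L) (x, u, v, w) (0, 0, Pi.single i 1, 0) := by
  have h1 : HasFDerivAt (uncL L) (fderiv ℝ (uncL L) (x, u, v, w))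
      (x, u, Function.update v i (v i), w) := by
    rw [Function.update_eq_self]; exact (hL.differentiable (by norm_num) _).hasFDerivAt
  have h2 := (hasDerivAt_const (v i) x).prodMk ((hasDerivAt_const (v i) u).prodMk
    ((update_path v i (v i)).prodMk (hasDerivAt_const (v i) w)))
  exact (h1.comp_hasDerivAt (v i) h2).deriv

lemma pW_eq (hL : ContDiff ℝ 1 (uncL L)) (x : ℝ) (u v w : Fin N → ℝ) (i : Fin N) :
    pW L x u v w i = fderiv ℝ (uncL L) (x, u, v, w) (0, 0, 0, Pi.single i 1) := by
  have h1 : HasFDerivAt (uncL L) (fderiv ℝ (uncL L) (x, u, v, w))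
      (x, u, v, Function.update w i (w i)) := by
    rw [Function.update_eq_self]; exact (hL.differentiable (by norm_num) _).hasFDerivAt
  have h2 := (hasDerivAt_const (w i) x).prodMk ((hasDerivAt_const (w i) u).prodMk
    ((hasDerivAt_const (w i) v).prodMk (update_path w i (w i))))
  exact (h1.comp_hasDerivAt (w i) h2).deriv

lemma fd_split (hL : ContDiff ℝ 1 (uncL L)) (x : ℝ) (u v w : Fin N → ℝ) (i : Fin N)
    (r s t : ℝ) :
    fderiv ℝ (uncL L) (x, u, v, w)
      (0, r • Pi.single i (1:ℝ), s • Pi.single i (1:ℝ), t • Pi.single i (1:ℝ)) =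
      r * pY L x u v w i + s * pV L x u v w i + t * pW L x u v w i := by
  rw [pY_eq hL, pV_eq hL, pW_eq hL, ← smul_eq_mul, ← smul_eq_mul, ← smul_eq_mul,
    ← map_smul, ← map_smul, ← map_smul, ← map_add, ← map_add]
  congr 1
  simp

end pd

/-- Euler–Lagrange equations for the basic combined-Caputo fractional variational problem:
a local minimizer `y` of `J(y) = ∫_a^b L[y](x) dx` subject to `y(a) = yᵃ`, `y(b) = yᵇ`
satisfies `∂ᵢL[y](x) − (d/dx)∂_{N+i}L[y](x) + D^{β,α}_{1−γ}∂_{2N+i}L[y](x) = 0`. -/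
theorem euler_lagrange_combined_caputo
    (a b α β γ : ℝ) (N : ℕ) (hab : a < b)
    (hα : α ∈ Ioo (0:ℝ) 1) (hβ : β ∈ Ioo (0:ℝ) 1) (hγ : γ ∈ Icc (0:ℝ) 1)
    (L : ℝ → (Fin N → ℝ) → (Fin N → ℝ) → (Fin N → ℝ) → ℝ)
    (hL : ContDiff ℝ 1 fun p : ℝ × (Fin N → ℝ) × (Fin N → ℝ) × (Fin N → ℝ) =>
      L p.1 p.2.1 p.2.2.1 p.2.2.2)
    (ya yb : Fin N → ℝ) (y : ℝ → Fin N → ℝ)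
    (hy : MemD a b α β γ y) (hya : y a = ya) (hyb : y b = yb)
    (hmin : ∃ δ > (0:ℝ), ∀ z : ℝ → Fin N → ℝ, MemD a b α β γ z → z a = ya → z b = yb →
      norm1inf a b α β γ (z - y) < δ → Jfun a b α β γ L y ≤ Jfun a b α β γ L z)
    (hC1 : ∀ i : Fin N, ContDiffOn1 a b (pVAlong a b α β γ L y i))
    (hRL : ∀ i : Fin N, HasContLeftRLD a b β (pWAlong a b α β γ L y i) ∧
      HasContRightRLD a b α (pWAlong a b α β γ L y i)) :
    ∀ i : Fin N, ∀ x ∈ Icc a b,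
      pYAlong a b α β γ L y i x - deriv (pVAlong a b α β γ L y i) x
        + combRLD a b β α γ (pWAlong a b α β γ L y i) x = 0 := by
  intro i
  obtain ⟨hyd, hyc, hyC⟩ := hy
  obtain ⟨δ, hδ, hmin⟩ := hmin
  change ContDiff ℝ 1 (uncL L) at hL
  set e : Fin N → ℝ := Pi.single i (1:ℝ) with he
  set p : ℝ → ℝ × (Fin N → ℝ) × (Fin N → ℝ) × (Fin N → ℝ) :=
    fun x => (x, y x, deriv y x, combCaputoVec a b α β γ y x) with hp
  have hycont : ContinuousOn y (Icc a b) := fun x hx => (hyd x hx).continuousAt.continuousWithinAt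
  have hpc : ContinuousOn p (Icc a b) :=
    continuousOn_id.prodMk (hycont.prodMk (hyc.prodMk hyC))
  have hF' : ContinuousOn (fun x => fderiv ℝ (uncL L) (p x)) (Icc a b) :=
    (hL.continuous_fderiv (by norm_num)).comp_continuousOn hpc
  have cY : ContinuousOn (pYAlong a b α β γ L y i) (Icc a b) :=
    (hF'.clm_apply (continuousOn_const (c := (0, e, 0, 0)))).congr fun x _ => pY_eq hL _ _ _ _ _
  have cV : ContinuousOn (pVAlong a b α β γ L y i) (Icc a b) :=
    (hF'.clm_apply (continuousOn_const (c := (0, 0, e, 0)))).congr fun x _ => pV_eq hL _ _ _ _ _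
  have cW : ContinuousOn (pWAlong a b α β γ L y i) (Icc a b) :=
    (hF'.clm_apply (continuousOn_const (c := (0, 0, 0, e)))).congr fun x _ => pW_eq hL _ _ _ _ _
  have cRL : ContinuousOn (combRLD a b β α γ (pWAlong a b α β γ L y i)) (Icc a b) :=
    ((hRL i).1.2.const_smul (1 - γ)).add ((hRL i).2.2.const_smul γ)
  have cE := (cY.sub (hC1 i).2).add cRL
  set Ef : ℝ → ℝ := fun x => pYAlong a b α β γ L y i x - deriv (pVAlong a b α β γ L y i) x
        + combRLD a b β α γ (pWAlong a b α β γ L y i) x with hEf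
  have cE : ContinuousOn Ef (Icc a b) := cE
  suffices h : ∀ᵐ x ∂(volume : Measure ℝ), x ∈ Ioo a b → Ef x = 0 by
    have h2 : Ef =ᵐ[volume.restrict (Icc a b)] (fun _ => (0:ℝ)) := by
      rw [Measure.restrict_congr_set Ioo_ae_eq_Icc.symm]
      exact (ae_restrict_iff' measurableSet_Ioo).2 h
    exact Measure.eqOn_Icc_of_ae_eq volume hab.ne h2 cE continuousOn_const
  refine isOpen_Ioo.ae_eq_zero_of_integral_contDiff_smul_eq_zero
    ((cE.mono Ioo_subset_Icc_self).locallyIntegrableOn measurableSet_Ioo) ?_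
  intro η hηs hηc hηt
  have hη : ContDiff ℝ 1 η := hηs.of_le (by exact_mod_cast le_top)
  have hη' : Continuous (deriv η) := hη.continuous_deriv (by norm_num)
  have hηd : Differentiable ℝ η := hη.differentiable (by norm_num)
  have hz : ∀ x, x ∉ Ioo a b → η x = 0 := fun x hx =>
    image_eq_zero_of_notMem_tsupport fun h => hx (hηt h)
  have hz' : ∀ x, x ∉ Ioo a b → deriv η x = 0 := fun x hx =>
    image_eq_zero_of_notMem_tsupport fun h => hx (hηt (tsupport_deriv_subset h))
  have h0a : η a = 0 := hz a (by simp)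
  have h0b : η b = 0 := hz b (by simp)
  set C : ℝ → ℝ := combCaputo a b α β γ η with hCdef
  have cC : ContinuousOn C (Icc a b) :=
    (((left_cont hab hα.1 hα.2 hη' hz' hηc.deriv).const_smul
      (1 / Real.Gamma (1 - α))).const_smul γ).add
    (((right_cont hab hβ.2 hη' hz' hηc.deriv).const_smul
      (-1 / Real.Gamma (1 - β))).const_smul (1 - γ))
  set q : ℝ → ℝ × (Fin N → ℝ) × (Fin N → ℝ) × (Fin N → ℝ) :=
    fun x => (0, η x • e, deriv η x • e, C x • e) with hq
  have hqc : ContinuousOn q (Icc a b) :=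
    continuousOn_const.prodMk ((hη.continuous.continuousOn.smul continuousOn_const).prodMk
      ((hη'.continuousOn.smul continuousOn_const).prodMk (cC.smul continuousOn_const)))
  have hvar := first_variation hab hL hpc hqc
  -- the perturbed curve
  set Y : ℝ → Fin N → ℝ := fun t => η t • e with hY
  have hYd : ∀ x, HasDerivAt Y (deriv η x • e) x := fun x =>
    (hηd x).hasDerivAt.smul_const e
  have zd : ∀ ε : ℝ, ∀ x ∈ Icc a b, HasDerivAt (y + fun t => ε • Y t)
      (deriv y x + ε • (deriv η x • e)) x := fun ε x hx =>
    (hyd x hx).hasDerivAt.add ((hYd x).const_smul ε)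
  have zC : ∀ ε : ℝ, ∀ x ∈ Icc a b, combCaputoVec a b α β γ (y + fun t => ε • Y t) x =
      combCaputoVec a b α β γ y x + ε • (C x • e) := by
    intro ε x hx
    ext j
    have e1 : (fun t => (y + fun t => ε • Y t) t j) = fun t => y t j + (ε * e j) * η t := by
      ext t; simp [hY]; ring
    have dj : ∀ x ∈ Icc a b, HasDerivAt (fun t => y t j) (deriv y x j) x :=
      fun x hx => hasDerivAt_comp_pi (hyd x hx) j
    simp only [combCaputoVec, Pi.add_apply, Pi.smul_apply, smul_eq_mul]
    simp only [combCaputoVec, Pi.add_apply, Pi.smul_apply, smul_eq_mul] at e1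
    rw [e1, combCaputo_add hα.2 hβ.2 hx (fun x hx => (dj x hx).differentiableAt)
      (fun x _ => (hηd x).const_mul _), combCaputo_const_mul]
    · ring
    · exact ((continuous_apply j).comp_continuousOn hyc).congr fun x hx => (dj x hx).deriv
    · rw [deriv_const_mul_field']
      exact (hη'.const_smul (ε * e j)).continuousOn
  have hJ : ∀ ε : ℝ, Jfun a b α β γ L (y + fun t => ε • Y t) =
      ∫ x in a..b, uncL L (p x + ε • q x) := by
    intro ε
    refine intervalIntegral.integral_congr fun x hx => ?_
    rw [uIcc_of_le hab.le] at hx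
    simp only [lagAlong, (zd ε x hx).deriv, zC ε x hx]
    simp [uncL, hp, hq, hY]
  have hmem : ∀ ε : ℝ, MemD a b α β γ (y + fun t => ε • Y t) := by
    intro ε
    refine ⟨fun x hx => (zd ε x hx).differentiableAt, ?_, ?_⟩
    · exact (hyc.add ((hη'.continuousOn.smul continuousOn_const).const_smul ε)).congr
        fun x hx => (zd ε x hx).deriv
    · exact (hyC.add ((cC.smul continuousOn_const).const_smul ε)).congr fun x hx => zC ε x hx
  have hloc : IsLocalMin (fun ε : ℝ => ∫ x in a..b, uncL L (p x + ε • q x)) 0 := by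
    have ht : Tendsto (fun ε : ℝ => |ε| * norm1inf a b α β γ Y) (𝓝 0) (𝓝 0) := by
      have : Continuous fun ε : ℝ => |ε| * norm1inf a b α β γ Y := by fun_prop
      simpa using this.tendsto 0
    filter_upwards [ht.eventually_lt_const hδ] with ε hε
    have h1 := hmin _ (hmem ε) (by simp [hY, h0a, hya]) (by simp [hY, h0b, hyb])
      (by rw [add_sub_cancel_left, norm1inf_scale]; exact hε)
    rw [hJ] at h1
    have h2 : ∫ x in a..b, uncL L (p x + (0:ℝ) • q x) = Jfun a b α β γ L y := by
      refine intervalIntegral.integral_congr fun x hx => ?_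
      simp [uncL, lagAlong, hp]
    exact h2.trans_le h1
  have hzero := hloc.hasDerivAt_eq_zero hvar
  have hsplit : ∫ x in a..b, fderiv ℝ (uncL L) (p x) (q x) =
      ∫ x in a..b, ((η x * pYAlong a b α β γ L y i x + deriv η x * pVAlong a b α β γ L y i x)
        + C x * pWAlong a b α β γ L y i x) := by
    congr 1; ext x
    exact fd_split hL _ _ _ _ i _ _ _
  have ii : ∀ {f : ℝ → ℝ}, ContinuousOn f (Icc a b) → IntervalIntegrable f volume a b :=
    fun hf => hf.intervalIntegrable_of_Icc hab.le
  have cη := hη.continuous.continuousOn (s := Icc a b)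
  have i1 : IntervalIntegrable (fun x => η x * pYAlong a b α β γ L y i x) volume a b :=
    ii (cη.mul cY)
  have i2 : IntervalIntegrable (fun x => deriv η x * pVAlong a b α β γ L y i x) volume a b :=
    ii (hη'.continuousOn.mul cV)
  have i3 : IntervalIntegrable (fun x => C x * pWAlong a b α β γ L y i x) volume a b :=
    ii (cC.mul cW)
  have i4 : IntervalIntegrable (fun x => η x * deriv (pVAlong a b α β γ L y i) x) volume a b :=
    ii (cη.mul (hC1 i).2)
  have i5 : IntervalIntegrable (fun x => η x * combRLD a b β α γ (pWAlong a b α β γ L y i) x) volume a b :=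
    ii (cη.mul cRL)
  have hibp := intervalIntegral.integral_mul_deriv_eq_deriv_mul (a := a) (b := b) (u := η)
      (u' := deriv η) (v := pVAlong a b α β γ L y i) (v' := deriv (pVAlong a b α β γ L y i))
      (fun x _ => (hηd x).hasDerivAt)
      (fun x hx => ((hC1 i).1 x (by rwa [uIcc_of_le hab.le] at hx)).hasDerivAt)
      (hη'.intervalIntegrable _ _) (ii (hC1 i).2)
  rw [h0a, h0b] at hibp
  have hfr := frac_ibp (γ := γ) hab hα hβ cW hη h0a h0b hηc hz' (hRL i).1 (hRL i).2
  rw [hsplit, intervalIntegral.integral_add (i1.add i2) i3, intervalIntegral.integral_add i1 i2,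
    hfr] at hzero
  have hfin : ∫ x, η x • Ef x = ∫ x in a..b, η x * Ef x := by
    rw [intervalIntegral.integral_of_le hab.le, setIntegral_eq_integral_of_forall_compl_eq_zero]
    · rfl
    · intro x hx
      rw [hz x (fun h => hx (Ioo_subset_Ioc_self h)), zero_mul]
  have hex : ∫ x in a..b, η x * Ef x = ∫ x in a..b, ((η x * pYAlong a b α β γ L y i x
      - η x * deriv (pVAlong a b α β γ L y i) x)
      + η x * combRLD a b β α γ (pWAlong a b α β γ L y i) x) := by
    congr 1; ext x; simp only [hEf]; ring
  rw [hfin, hex, intervalIntegral.integral_add (i1.sub i4) i5, intervalIntegral.integral_sub i1 i4]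
  linarith

end
end
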